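/- Let G be a connected natural unit interval graph on {1,…,n} with no cut vertex and let λ be a partition of the form λ = (μ_1,…,μ_k,2,…,2,1,…,1) for some partition μ = (μ_1,…,μ_k). If |μ| ≤ 4, then the coefficient c_λ(q) of e_λ in X_G(x;q) is a polynomial in q with nonnegative coefficients. If |μ| ≤ 8, then the coefficient c_λ of e_λ in X_G(x) is nonnegative. -/

import Mathlib

open Finset MvPolynomial
open scoped Classical

noncomputable section

/-- `κ` is a proper colouring of `G`. -/
def IsProper {n N : ℕ} (G : SimpleGraph (Fin n)) (κ : Fin n → Fin N) : Prop :=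
  ∀ i j, G.Adj i j → κ i ≠ κ j

/-- The chromatic symmetric function of `G`, truncated to `N` variables. -/
def chromSym (n N : ℕ) (G : SimpleGraph (Fin n)) : MvPolynomial (Fin N) ℤ :=
  ∑ κ : Fin n → Fin N, if IsProper G κ then ∏ i, X (κ i) else 0

/-- The number of ascents of a colouring. -/
def ascNum {n N : ℕ} (G : SimpleGraph (Fin n)) (κ : Fin n → Fin N) : ℕ :=
  ((Finset.univ : Finset (Fin n × Fin n)).filter fun p =>
    G.Adj p.1 p.2 ∧ p.1 < p.2 ∧ κ p.1 < κ p.2).card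

/-- The chromatic quasisymmetric function of `G`, with coefficients in `ℤ[q]`,
truncated to `N` variables. -/
def chromQSym (n N : ℕ) (G : SimpleGraph (Fin n)) :
    MvPolynomial (Fin N) (Polynomial ℤ) :=
  ∑ κ : Fin n → Fin N, if IsProper G κ then
    C (Polynomial.X ^ ascNum G κ) * ∏ i, X (κ i) else 0

/-- `e_λ`, the product of elementary symmetric polynomials over the parts of `λ`. -/
def eProd (N : ℕ) (R : Type) [CommSemiring R] {n : ℕ} (p : Nat.Partition n) :
    MvPolynomial (Fin N) R :=
  (p.parts.map fun k => esymm (Fin N) R k).prod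

/-- The number of parts of a partition, i.e. `λ'_1`. -/
def numParts {n : ℕ} (p : Nat.Partition n) : ℕ := Multiset.card p.parts

/-- The largest part `λ_1` of a partition. -/
def maxPart {n : ℕ} (p : Nat.Partition n) : ℕ := p.parts.sup

/-- `λ'_1 + ⋯ + λ'_k`, the number of cells in the first `k` columns of `λ`. -/
def conjSum {n : ℕ} (p : Nat.Partition n) (k : ℕ) : ℕ :=
  (p.parts.map fun a => min a k).sum

/-- `λ_1 + ⋯ + λ_k`, the number of cells in the first `k` rows of `λ`. -/
def partSum {n : ℕ} (p : Nat.Partition n) (k : ℕ) : ℕ :=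
  ∑ j ∈ Finset.Icc 1 n, min (Multiset.card (p.parts.filter fun a => j ≤ a)) k

/-- `s` is an independent set of vertices of `G`. -/
def IsIndepFinset {V : Type} (G : SimpleGraph V) (s : Finset V) : Prop :=
  ∀ i ∈ s, ∀ j ∈ s, ¬ G.Adj i j

/-- `s` is a clique of `G`. -/
def IsCliqueFinset {V : Type} (G : SimpleGraph V) (s : Finset V) : Prop :=
  ∀ i ∈ s, ∀ j ∈ s, i ≠ j → G.Adj i j

/-- The independence number `α(G)`. -/
def indepNum {n : ℕ} (G : SimpleGraph (Fin n)) : ℕ :=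
  sSup {k | ∃ s : Finset (Fin n), IsIndepFinset G s ∧ s.card = k}

/-- The clique number `ω(G)`. -/
def cliqueNum {n : ℕ} (G : SimpleGraph (Fin n)) : ℕ :=
  sSup {k | ∃ s : Finset (Fin n), IsCliqueFinset G s ∧ s.card = k}

/-- `α_k(G)`: the maximum number of vertices in an independent partition
with `k` blocks. -/
def alphaK {n : ℕ} (G : SimpleGraph (Fin n)) (k : ℕ) : ℕ :=
  sSup {m | ∃ B : Fin k → Finset (Fin n),
    (∀ i j, i ≠ j → Disjoint (B i) (B j)) ∧
    (∀ i, IsIndepFinset G (B i)) ∧ m = ∑ i, (B i).card}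

/-- `ω_k(G)`: the maximum number of vertices in a clique partition
with `k` blocks. -/
def omegaK {n : ℕ} (G : SimpleGraph (Fin n)) (k : ℕ) : ℕ :=
  sSup {m | ∃ B : Fin k → Finset (Fin n),
    (∀ i j, i ≠ j → Disjoint (B i) (B j)) ∧
    (∀ i, IsCliqueFinset G (B i)) ∧ m = ∑ i, (B i).card}

/-- `G` is a natural unit interval graph. -/
def IsNUIG {n : ℕ} (G : SimpleGraph (Fin n)) : Prop :=
  ∀ i j k : Fin n, i < j → j < k → G.Adj i k → G.Adj i j ∧ G.Adj j k

/-- The `q`-integer `[k]_q = 1 + q + ⋯ + q^(k-1)` in `ℤ[q]`. -/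
def qInt (k : ℕ) : Polynomial ℤ := ∑ i ∈ Finset.range k, Polynomial.X ^ i

/-- The `q`-factorial `[k]_q!` in `ℤ[q]`. -/
def qFact : ℕ → Polynomial ℤ
  | 0 => 1
  | k + 1 => qInt (k + 1) * qFact k

end

/-- `v` is a cut vertex: its removal disconnects the graph. -/
def IsCutVertex {n : ℕ} (G : SimpleGraph (Fin n)) (v : Fin n) : Prop :=
  ¬ (G.induce {u | u ≠ v}).Preconnected


namespace SS

section Generic

variable {K : Type*} [Field K] [CharZero K] {α : Type*} [Fintype α] [DecidableEq α]

/-- The set of letters of the word `w` at positions in `[lo, m)`. -/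
def seg {n : ℕ} (w : Fin n → α) (lo m : ℕ) : Finset α :=
  (Finset.univ.filter (fun k : Fin n => lo ≤ (k : ℕ) ∧ (k : ℕ) < m)).image w

/-- The weight of a word. -/
def wt (ψ : Finset α → α → K) (r : ℕ → ℕ) {n : ℕ} (w : Fin n → α) : K :=
  ∏ m : Fin n, ψ (seg w (r m) m) (w m)

/-- The weighted sum over all words. -/
def Zsum (ψ : Finset α → α → K) (f : α → K) (n : ℕ) (r : ℕ → ℕ) : K :=
  ∑ w : Fin n → α, wt ψ r w * ∏ m, f (w m)

/-- The local identities on transition weights needed for the modular law. -/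
structure Good (ψ : Finset α → α → K) : Prop where
  zero : ∀ S c, c ∈ S → ψ S c = 0
  one : ∀ S' S : Finset α, ∀ c d e : α, c ≠ d → c ∉ S → d ∉ S → c ∉ S' → d ∉ S' →
    ψ S' c * ψ (insert c S') d *
      (ψ (insert c (insert d S)) e + ψ S e - 2 * ψ (insert d S) e) +
    ψ S' d * ψ (insert d S') c *
      (ψ (insert c (insert d S)) e + ψ S e - 2 * ψ (insert c S) e) = 0
  two : ∀ S : Finset α, ∀ u c d : α, u ∉ S → c ≠ d → c ∉ S → d ∉ S →
    ψ S c * ψ (insert c S) d + ψ (insert u S) c * ψ (insert c (insert u S)) d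
      - 2 * (ψ (insert u S) c * ψ (insert c S) d) +
    (ψ S d * ψ (insert d S) c + ψ (insert u S) d * ψ (insert d (insert u S)) c
      - 2 * (ψ (insert u S) d * ψ (insert d S) c)) = 0

lemma mem_seg {n : ℕ} {w : Fin n → α} {lo m : ℕ} {a : α} :
    a ∈ seg w lo m ↔ ∃ k : Fin n, (lo ≤ (k : ℕ) ∧ (k : ℕ) < m) ∧ w k = a := by
  simp [seg]

lemma seg_left {n : ℕ} (w : Fin n → α) (p : Fin n) (m : ℕ) (h : (p : ℕ) < m) :
    seg w p m = insert (w p) (seg w (p + 1) m) := by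
  ext a
  simp only [mem_seg, Finset.mem_insert]
  constructor
  · rintro ⟨k, ⟨h1, h2⟩, rfl⟩
    by_cases hk : k = p
    · left; rw [hk]
    · right
      refine ⟨k, ⟨?_, h2⟩, rfl⟩
      have : (k : ℕ) ≠ p := fun h => hk (Fin.ext h)
      omega
  · rintro (rfl | ⟨k, ⟨h1, h2⟩, rfl⟩)
    · exact ⟨p, ⟨le_refl _, h⟩, rfl⟩
    · exact ⟨k, ⟨by omega, h2⟩, rfl⟩

lemma seg_right {n : ℕ} (w : Fin n → α) (p : Fin n) (lo : ℕ) (h : lo ≤ (p : ℕ)) :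
    seg w lo (p + 1) = insert (w p) (seg w lo p) := by
  ext a
  simp only [mem_seg, Finset.mem_insert]
  constructor
  · rintro ⟨k, ⟨h1, h2⟩, rfl⟩
    by_cases hk : k = p
    · left; rw [hk]
    · right
      refine ⟨k, ⟨h1, ?_⟩, rfl⟩
      have : (k : ℕ) ≠ p := fun h => hk (Fin.ext h)
      omega
  · rintro (rfl | ⟨k, ⟨h1, h2⟩, rfl⟩)
    · exact ⟨p, ⟨h, by omega⟩, rfl⟩
    · exact ⟨k, ⟨h1, by omega⟩, rfl⟩

lemma seg_swap {n : ℕ} (w : Fin n → α) (p p' : Fin n) (hp : (p' : ℕ) = p + 1) (lo m : ℕ)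
    (h : (lo ≤ (p : ℕ) ∧ (p : ℕ) + 1 < m) ∨ m ≤ (p : ℕ) ∨ (p : ℕ) + 2 ≤ lo) :
    seg (w ∘ Equiv.swap p p') lo m = seg w lo m := by
  have key : ∀ v : Fin n → α, ∀ a, a ∈ seg v lo m → a ∈ seg (v ∘ Equiv.swap p p') lo m := by
    intro v a
    simp only [mem_seg]
    rintro ⟨k, ⟨h1, h2⟩, rfl⟩
    refine ⟨Equiv.swap p p' k, ?_, by simp⟩
    by_cases hk : k = p
    · subst hk
      rw [Equiv.swap_apply_left]; omega
    · by_cases hk' : k = p'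
      · subst hk'
        rw [Equiv.swap_apply_right]; omega
      · rw [Equiv.swap_apply_of_ne_of_ne hk hk']; exact ⟨h1, h2⟩
  ext a
  constructor
  · intro ha
    have := key _ _ ha
    have e : (w ∘ Equiv.swap p p') ∘ Equiv.swap p p' = w := by
      funext x; simp
    rwa [e] at this
  · exact key w a

/-- Summation by swapping two letters. -/
lemma sum_swap_zero {n : ℕ} (p p' : Fin n) (T : (Fin n → α) → K)
    (h : ∀ w, T w + T (w ∘ Equiv.swap p p') = 0) : ∑ w, T w = 0 := by
  have e : ∑ w, T (w ∘ Equiv.swap p p') = ∑ w, T w :=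
    Fintype.sum_equiv (Equiv.arrowCongr (Equiv.swap p p') (Equiv.refl α)) _ _ (by
      intro w; congr 1)
  have : ∑ w, (T w + T (w ∘ Equiv.swap p p')) = 0 := Finset.sum_eq_zero (fun w _ => h w)
  rw [Finset.sum_add_distrib, e] at this
  have h2 : (2 : K) * ∑ w, T w = 0 := by rw [two_mul]; exact this
  simpa using h2

lemma prod_swap {n : ℕ} (p p' : Fin n) (f : α → K) (w : Fin n → α) :
    ∏ m, f ((w ∘ Equiv.swap p p') m) = ∏ m, f (w m) :=
  Fintype.prod_equiv (Equiv.swap p p') _ _ (by intro x; rfl)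

lemma prod3 {n : ℕ} (g : Fin n → K) (a b c : Fin n) (hab : a ≠ b) (hac : a ≠ c) (hbc : b ≠ c) :
    ∏ m, g m = g a * g b * g c * ∏ m ∈ ((Finset.univ.erase a).erase b).erase c, g m := by
  rw [← Finset.mul_prod_erase Finset.univ g (Finset.mem_univ a),
    ← Finset.mul_prod_erase (Finset.univ.erase a) g (a := b) (by simp [hab.symm]),
    ← Finset.mul_prod_erase ((Finset.univ.erase a).erase b) g (a := c)
      (by simp [hac.symm, hbc.symm])]
  ring

lemma prod2 {n : ℕ} (g : Fin n → K) (a b : Fin n) (hab : a ≠ b) :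
    ∏ m, g m = g a * g b * ∏ m ∈ ((Finset.univ.erase a).erase b), g m := by
  rw [← Finset.mul_prod_erase Finset.univ g (Finset.mem_univ a),
    ← Finset.mul_prod_erase (Finset.univ.erase a) g (a := b) (by simp [hab.symm])]
  ring

theorem law_one {ψ : Finset α → α → K} (hψ : Good ψ) (f : α → K) (n : ℕ) (r : ℕ → ℕ)
    (i m : ℕ) (hmn : m < n) (him : i + 2 ≤ m) (hri : r i ≤ i) (hr : r i = r (i + 1))
    (hlo : ∀ k, k < m → r k ≤ i) (hhi : ∀ k, m < k → k < n → i + 2 ≤ r k) :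
    Zsum ψ f n (Function.update r m i) + Zsum ψ f n (Function.update r m (i + 2))
      = 2 * Zsum ψ f n (Function.update r m (i + 1)) := by
  rw [← sub_eq_zero]
  unfold Zsum
  rw [Finset.mul_sum, ← Finset.sum_add_distrib, ← Finset.sum_sub_distrib]
  let p : Fin n := ⟨i, by omega⟩
  let p' : Fin n := ⟨i + 1, by omega⟩
  let t : Fin n := ⟨m, hmn⟩
  have hpp : p ≠ p' := by simp [p, p', Fin.ext_iff]
  have hpt : p ≠ t := by simp [p, t, Fin.ext_iff]; omega
  have hpt' : p' ≠ t := by simp [p', t, Fin.ext_iff]; omega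
  -- the shape of a weight
  let Rest : (Fin n → α) → K := fun w =>
    ∏ k ∈ ((Finset.univ.erase p).erase p').erase t, ψ (seg w (r k) k) (w k)
  have hw : ∀ (w : Fin n → α) (x : ℕ), wt ψ (Function.update r m x) w =
      ψ (seg w (r i) i) (w p) * ψ (insert (w p) (seg w (r i) i)) (w p') *
        ψ (seg w x m) (w t) * Rest w := by
    intro w x
    unfold wt
    rw [prod3 _ p p' t hpp hpt hpt']
    have e1 : (Function.update r m x) (p : ℕ) = r i := by
      simp only [p]; rw [Function.update_of_ne (by omega)]
    have e2 : (Function.update r m x) (p' : ℕ) = r i := by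
      simp only [p']; rw [Function.update_of_ne (by omega), hr]
    have e3 : (Function.update r m x) (t : ℕ) = x := by simp [t]
    rw [e1, e2, e3]
    have e4 : seg w (r i) (p' : ℕ) = insert (w p) (seg w (r i) i) := seg_right w p _ hri
    rw [e4]
    congr 1
    refine Finset.prod_congr rfl (fun k hk => ?_)
    simp only [Finset.mem_erase, ne_eq] at hk
    have : (k : ℕ) ≠ m := fun h => hk.1 (Fin.ext h)
    rw [Function.update_of_ne this]
  have hRest : ∀ w, Rest (w ∘ Equiv.swap p p') = Rest w := by
    intro w
    refine Finset.prod_congr rfl (fun k hk => ?_)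
    simp only [Finset.mem_erase, ne_eq, Finset.mem_univ, and_true] at hk
    obtain ⟨h1, h2, h3⟩ := hk
    have h1' : (k : ℕ) ≠ m := fun h => h1 (Fin.ext h)
    have h2' : (k : ℕ) ≠ i + 1 := fun h => h2 (Fin.ext h)
    have h3' : (k : ℕ) ≠ i := fun h => h3 (Fin.ext h)
    rw [seg_swap w p p' rfl]
    · congr 1
      simp [Equiv.swap_apply_of_ne_of_ne h3 h2]
    · rcases lt_trichotomy (k : ℕ) m with h | h | h
      · have := hlo k h
        simp only [p]; omega
      · omega
      · have := hhi k h k.2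
        simp only [p]; omega
  apply sum_swap_zero p p'
  intro w
  rw [prod_swap]
  simp only [hw, hRest]
  have s0 : seg (w ∘ Equiv.swap p p') (r i) i = seg w (r i) i :=
    seg_swap w p p' rfl _ _ (Or.inr (Or.inl (le_refl _)))
  have s2 : seg (w ∘ Equiv.swap p p') (i + 2) m = seg w (i + 2) m :=
    seg_swap w p p' rfl _ _ (Or.inr (Or.inr (le_refl _)))
  have sA : ∀ v : Fin n → α, seg v (i + 1) m = insert (v p') (seg v (i + 2) m) :=
    fun v => seg_left v p' m (by simp only [p']; omega)
  have sB : ∀ v : Fin n → α, seg v i m = insert (v p) (insert (v p') (seg v (i + 2) m)) :=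
    fun v => by rw [← sA]; exact seg_left v p m (by simp only [p]; omega)
  simp only [sA, sB, s0, s2]
  have c1 : (w ∘ Equiv.swap p p') p = w p' := by simp
  have c2 : (w ∘ Equiv.swap p p') p' = w p := by simp
  have c3 : (w ∘ Equiv.swap p p') t = w t := by
    simp [Equiv.swap_apply_of_ne_of_ne hpt.symm hpt'.symm]
  rw [c1, c2, c3]
  set c := w p
  set d := w p'
  set S := seg w (i + 2) m with hS
  set S' := seg w (r i) i
  set e := w t
  by_cases hcd : c = d
  · rw [hcd, hψ.zero (insert d S') d (Finset.mem_insert_self _ _)]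
    ring
  have restz : ∀ a, (a = c ∨ a = d) → a ∈ S → Rest w = 0 := by
    intro a ha haS
    rw [hS, mem_seg] at haS
    obtain ⟨k, ⟨h1, h2⟩, h3⟩ := haS
    apply Finset.prod_eq_zero (i := k)
    · simp only [Finset.mem_erase, ne_eq, Finset.mem_univ, and_true, Fin.ext_iff, p, p', t]
      omega
    · apply hψ.zero
      rw [h3, mem_seg]
      have := hlo k h2
      rcases ha with rfl | rfl
      · exact ⟨p, ⟨by simp only [p]; omega, by simp only [p]; omega⟩, rfl⟩
      · exact ⟨p', ⟨by simp only [p']; omega, by simp only [p']; omega⟩, rfl⟩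
  by_cases hc : c ∈ S
  · rw [restz c (Or.inl rfl) hc]; ring
  by_cases hd : d ∈ S
  · rw [restz d (Or.inr rfl) hd]; ring
  by_cases hc' : c ∈ S'
  · rw [hψ.zero S' c hc', hψ.zero (insert d S') c (Finset.mem_insert_of_mem hc')]; ring
  by_cases hd' : d ∈ S'
  · rw [hψ.zero S' d hd', hψ.zero (insert c S') d (Finset.mem_insert_of_mem hd')]; ring
  have := hψ.one S' S c d e hcd hc hd hc' hd'
  rw [Finset.insert_comm d c S]
  linear_combination (Rest w * ∏ m, f (w m)) * this

theorem law_two {ψ : Finset α → α → K} (hψ : Good ψ) (f : α → K) (n : ℕ) (r : ℕ → ℕ)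
    (y m : ℕ) (hmn : m + 1 < n) (hy : y + 1 ≤ m) (hm : r m = y) (hm1 : r (m + 1) = y + 1)
    (hno : ∀ k, k < n → r k ≠ m + 1) :
    Zsum ψ f n (Function.update r m (y + 1)) + Zsum ψ f n (Function.update r (m + 1) y)
      = 2 * Zsum ψ f n r := by
  rw [← sub_eq_zero]
  unfold Zsum
  rw [Finset.mul_sum, ← Finset.sum_add_distrib, ← Finset.sum_sub_distrib]
  let q : Fin n := ⟨y, by omega⟩
  let p : Fin n := ⟨m, by omega⟩
  let p' : Fin n := ⟨m + 1, by omega⟩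
  have hpp : p ≠ p' := by simp [p, p', Fin.ext_iff]
  have hqp : q ≠ p := by simp [q, p, Fin.ext_iff]; omega
  have hqp' : q ≠ p' := by simp [q, p', Fin.ext_iff]; omega
  let Rest : (Fin n → α) → K := fun w =>
    ∏ k ∈ ((Finset.univ.erase p).erase p'), ψ (seg w (r k) k) (w k)
  have hw : ∀ (w : Fin n → α) (r' : ℕ → ℕ), (∀ k, k ≠ m → k ≠ m + 1 → r' k = r k) →
      (r' (m + 1) ≤ m) → wt ψ r' w =
      ψ (seg w (r' m) m) (w p) * ψ (insert (w p) (seg w (r' (m + 1)) m)) (w p') * Rest w := by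
    intro w r' hr' hle
    unfold wt
    rw [prod2 _ p p' hpp]
    have e4 : seg w (r' (m + 1)) (p' : ℕ) = insert (w p) (seg w (r' (m + 1)) m) :=
      seg_right w p _ hle
    have e5 : ((p' : Fin n) : ℕ) = m + 1 := rfl
    rw [e5] at e4
    simp only [e5, e4]
    congr 1
    refine Finset.prod_congr rfl (fun k hk => ?_)
    simp only [Finset.mem_erase, ne_eq, Finset.mem_univ, and_true] at hk
    rw [hr' k (fun h => hk.2 (Fin.ext h)) (fun h => hk.1 (Fin.ext h))]
  have hRest : ∀ w, Rest (w ∘ Equiv.swap p p') = Rest w := by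
    intro w
    refine Finset.prod_congr rfl (fun k hk => ?_)
    simp only [Finset.mem_erase, ne_eq, Finset.mem_univ, and_true] at hk
    obtain ⟨h2, h3⟩ := hk
    have h2' : (k : ℕ) ≠ m + 1 := fun h => h2 (Fin.ext h)
    have h3' : (k : ℕ) ≠ m := fun h => h3 (Fin.ext h)
    rw [seg_swap w p p' rfl]
    · congr 1
      simp [Equiv.swap_apply_of_ne_of_ne h3 h2]
    · have := hno k k.2
      simp only [p]; omega
  apply sum_swap_zero p p'
  intro w
  rw [prod_swap]
  have w1 : ∀ v : Fin n → α, wt ψ r v =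
      ψ (seg v y m) (v p) * ψ (insert (v p) (seg v (y + 1) m)) (v p') * Rest v := by
    intro v
    rw [hw v r (fun _ _ _ => rfl) (by omega), hm, hm1]
  have w2 : ∀ v : Fin n → α, wt ψ (Function.update r m (y + 1)) v =
      ψ (seg v (y + 1) m) (v p) * ψ (insert (v p) (seg v (y + 1) m)) (v p') * Rest v := by
    intro v
    rw [hw v _ (fun k hk _ => by rw [Function.update_of_ne hk])
      (by rw [Function.update_of_ne (by omega)]; omega)]
    rw [Function.update_self, Function.update_of_ne (by omega), hm1]
  have w3 : ∀ v : Fin n → α, wt ψ (Function.update r (m + 1) y) v =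
      ψ (seg v y m) (v p) * ψ (insert (v p) (seg v y m)) (v p') * Rest v := by
    intro v
    rw [hw v _ (fun k _ hk => by rw [Function.update_of_ne hk])
      (by rw [Function.update_self]; omega)]
    rw [Function.update_self, Function.update_of_ne (by omega), hm]
  simp only [w1, w2, w3, hRest]
  have s0 : seg (w ∘ Equiv.swap p p') (y + 1) m = seg w (y + 1) m :=
    seg_swap w p p' rfl _ _ (Or.inr (Or.inl (le_refl _)))
  have sA : ∀ v : Fin n → α, seg v y m = insert (v q) (seg v (y + 1) m) :=
    fun v => seg_left v q m (by simp only [q]; omega)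
  simp only [sA, s0]
  have c1 : (w ∘ Equiv.swap p p') p = w p' := by simp
  have c2 : (w ∘ Equiv.swap p p') p' = w p := by simp
  have c3 : (w ∘ Equiv.swap p p') q = w q := by
    simp [Equiv.swap_apply_of_ne_of_ne hqp hqp']
  rw [c1, c2, c3]
  set c := w p
  set d := w p'
  set S := seg w (y + 1) m with hS
  set u := w q
  by_cases hcd : c = d
  · rw [hcd, hψ.zero (insert d S) d (Finset.mem_insert_self _ _),
      hψ.zero (insert d (insert u S)) d (Finset.mem_insert_self _ _)]
    ring
  by_cases hu : u ∈ S
  · rw [Finset.insert_eq_of_mem hu]; ring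
  by_cases hc : c ∈ S
  · rw [hψ.zero S c hc, hψ.zero (insert d S) c (Finset.mem_insert_of_mem hc),
      hψ.zero (insert u S) c (Finset.mem_insert_of_mem hc),
      hψ.zero (insert d (insert u S)) c
        (Finset.mem_insert_of_mem (Finset.mem_insert_of_mem hc))]; ring
  by_cases hd : d ∈ S
  · rw [hψ.zero S d hd, hψ.zero (insert c S) d (Finset.mem_insert_of_mem hd),
      hψ.zero (insert u S) d (Finset.mem_insert_of_mem hd),
      hψ.zero (insert c (insert u S)) d
        (Finset.mem_insert_of_mem (Finset.mem_insert_of_mem hd))]; ring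
  have := hψ.two S u c d hu hcd hc hd
  linear_combination (Rest w * ∏ m, f (w m)) * this

end Generic

end SS

namespace SS

section Psi

variable {K : Type*} [Field K] [CharZero K] {N : ℕ}

/-- The transition weights for proper colourings. -/
def psiX (K : Type*) [Field K] (S : Finset (Fin N)) (c : Fin N) : K := if c ∈ S then 0 else 1

theorem good_psiX : Good (psiX K : Finset (Fin N) → Fin N → K) where
  zero := by intro S c h; simp [psiX, h]
  one := by
    intro S' S c d e hcd hc hd hc' hd'
    simp only [psiX, Finset.mem_insert, hcd, hcd.symm, hc', hd', or_false, if_false]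
    by_cases h1 : e = c
    · subst h1; simp [hcd, hc]; norm_num
    · by_cases h2 : e = d
      · subst h2; simp [h1, hd]; norm_num
      · simp [h1, h2]; split_ifs <;> norm_num
  two := by
    intro S u c d hu hcd hc hd
    simp only [psiX, Finset.mem_insert, hcd, hcd.symm, hc, hd, or_false, if_false]
    by_cases h1 : c = u
    · have : d ≠ u := fun h => hcd (h1.trans h.symm)
      simp [h1, this]; norm_num
    · by_cases h2 : d = u
      · simp [h1, h2]; norm_num
      · simp [h1, h2]; norm_num

/-- Hikita's factors at `q = 1`. -/
def gH (K : Type*) [Field K] (j c : Fin N) : K :=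
  if (j : ℕ) + 1 = c then 1 else (((c : ℕ) : K) - ((j : ℕ) : K)) / (((c : ℕ) : K) - 1 - ((j : ℕ) : K))

/-- Admissibility of a letter. -/
def chi (K : Type*) [Field K] (S : Finset (Fin N)) (c : Fin N) : K :=
  if (c : ℕ) = 0 ∨ ∃ j ∈ S, (j : ℕ) + 1 = c then 1 else 0

/-- Hikita's transition weights at `q = 1`. -/
def psiH (K : Type*) [Field K] (S : Finset (Fin N)) (c : Fin N) : K :=
  (1 / ((max (c : ℕ) 1 : ℕ) : K)) * chi K S c * ∏ j ∈ S, gH K j c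

lemma chi_insert (S : Finset (Fin N)) (u c : Fin N) :
    chi K (insert u S) c = if (u : ℕ) + 1 = c then 1 else chi K S c := by
  unfold chi
  by_cases h : (u : ℕ) + 1 = c
  · simp [h]
  · simp [h]

lemma chi_zero (S : Finset (Fin N)) (c d : Fin N) (hc : c ∉ S) (h : (c : ℕ) + 1 = d) :
    chi K S d = 0 := by
  unfold chi
  rw [if_neg]
  rintro (h0 | ⟨j, hj, h1⟩)
  · omega
  · have : j = c := Fin.ext (by omega)
    exact hc (this ▸ hj)

lemma psiH_insert (S : Finset (Fin N)) (u c : Fin N) (hu : u ∉ S) :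
    psiH K (insert u S) c = (1 / ((max (c : ℕ) 1 : ℕ) : K)) *
      (if (u : ℕ) + 1 = c then 1 else chi K S c) * (gH K u c * ∏ j ∈ S, gH K j c) := by
  unfold psiH
  rw [chi_insert, Finset.prod_insert hu]

lemma psiH_insert2 (S : Finset (Fin N)) (u v c : Fin N) (hu : u ∉ S) (hv : v ∉ S) (huv : u ≠ v) :
    psiH K (insert u (insert v S)) c = (1 / ((max (c : ℕ) 1 : ℕ) : K)) *
      (if (u : ℕ) + 1 = c then 1 else if (v : ℕ) + 1 = c then 1 else chi K S c) *
      (gH K u c * (gH K v c * ∏ j ∈ S, gH K j c)) := by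
  unfold psiH
  rw [chi_insert, chi_insert, Finset.prod_insert (by simp [hu, huv]), Finset.prod_insert hv]

lemma gH_self (c : Fin N) : gH K c c = 0 := by simp [gH]

lemma den_ne (j c : ℕ) (h : ¬ (j + 1 = c)) : ((c : ℕ) : K) - 1 - ((j : ℕ) : K) ≠ 0 := by
  intro h'
  apply h
  have : ((c : ℕ) : K) = ((j + 1 : ℕ) : K) := by push_cast; linear_combination h'
  exact (Nat.cast_injective this).symm

lemma gH_cases (S : Finset (Fin N)) (j c : Fin N) (hj : j ∉ S) :
    ((j : ℕ) + 1 = c ∧ gH K j c = 1 ∧ chi K S c = 0 ∧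
      ∀ x : K, (if (j : ℕ) + 1 = c then 1 else x) = 1) ∨
    (¬ ((j : ℕ) + 1 = c) ∧ (((c : ℕ) : K) - 1 - ((j : ℕ) : K) ≠ 0) ∧
      gH K j c = (((c : ℕ) : K) - ((j : ℕ) : K)) / (((c : ℕ) : K) - 1 - ((j : ℕ) : K)) ∧
      ∀ x : K, (if (j : ℕ) + 1 = c then 1 else x) = x) := by
  by_cases h : (j : ℕ) + 1 = c
  · exact Or.inl ⟨h, by simp [gH, h], chi_zero S j c hj h, fun x => by simp [h]⟩
  · exact Or.inr ⟨h, den_ne _ _ h, by simp [gH, h], fun x => by simp [h]⟩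

lemma psiH_mem (S : Finset (Fin N)) (c : Fin N) (h : c ∈ S) : psiH K S c = 0 := by
  unfold psiH
  rw [Finset.prod_eq_zero h (gH_self c), mul_zero]

lemma psiH_exch (S : Finset (Fin N)) (c d : Fin N) (hcd : c ≠ d) (hc : c ∉ S) (hd : d ∉ S) :
    psiH K S c * psiH K (insert c S) d + psiH K S d * psiH K (insert d S) c =
      2 * (psiH K (insert c S) d * psiH K (insert d S) c) := by
  have hvcd : (c : ℕ) ≠ d := fun h => hcd (Fin.ext h)
  rw [psiH_insert _ _ _ hc, psiH_insert _ _ _ hd]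
  unfold psiH
  generalize (1 / ((max (c : ℕ) 1 : ℕ) : K)) = a1
  generalize (1 / ((max (d : ℕ) 1 : ℕ) : K)) = a2
  generalize ∏ j ∈ S, gH K j c = P1
  generalize ∏ j ∈ S, gH K j d = P2
  have g1 := gH_cases (K := K) S c d hc
  have g2 := gH_cases (K := K) S d c hd
  generalize gH K c d = y1 at *
  generalize gH K d c = y2 at *
  generalize chi K S c = x1 at *
  generalize chi K S d = x2 at *
  generalize (c : ℕ) = C at *
  generalize (d : ℕ) = D at *
  clear hc hd hcd
  rcases g1 with ⟨h1, rfl, z1, i1⟩ | ⟨h1, n1, rfl, i1⟩ <;>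
  rcases g2 with ⟨h2, rfl, z2, i2⟩ | ⟨h2, n2, rfl, i2⟩ <;>
  try (exfalso; omega)
  all_goals simp only [i1, i2]
  all_goals clear i1 i2
  all_goals try subst z1
  all_goals try subst z2
  all_goals try subst h1
  all_goals try subst h2
  all_goals push_cast at *
  all_goals ring_nf at *
  all_goals field_simp
  all_goals ring

theorem good_psiH : Good (psiH K : Finset (Fin N) → Fin N → K) where
  zero := by
    intro S c h
    unfold psiH
    rw [Finset.prod_eq_zero h (gH_self c), mul_zero]
  one := by
    intro S' S c d e hcd hc hd hc' hd'
    have hvcd : (c : ℕ) ≠ d := fun h => hcd (Fin.ext h)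
    rw [psiH_insert _ _ _ hc', psiH_insert _ _ _ hd', psiH_insert2 _ _ _ _ hc hd hcd,
      psiH_insert _ _ _ hc, psiH_insert _ _ _ hd]
    unfold psiH
    generalize (1 / ((max (c : ℕ) 1 : ℕ) : K)) = a1
    generalize (1 / ((max (d : ℕ) 1 : ℕ) : K)) = a2
    generalize (1 / ((max (e : ℕ) 1 : ℕ) : K)) = a3
    generalize ∏ j ∈ S', gH K j c = P1
    generalize ∏ j ∈ S', gH K j d = P2
    generalize ∏ j ∈ S, gH K j e = P3
    have g1 := gH_cases (K := K) S' c d hc'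
    have g2 := gH_cases (K := K) S' d c hd'
    have g3 := gH_cases (K := K) S c e hc
    have g4 := gH_cases (K := K) S d e hd
    generalize gH K c d = y1 at *
    generalize gH K d c = y2 at *
    generalize gH K c e = y3 at *
    generalize gH K d e = y4 at *
    generalize chi K S' c = x1 at *
    generalize chi K S' d = x2 at *
    generalize chi K S e = x3 at *
    generalize (c : ℕ) = C at *
    generalize (d : ℕ) = D at *
    generalize (e : ℕ) = E at *
    clear hc hd hc' hd' hcd
    rcases g1 with ⟨h1, rfl, z1, i1⟩ | ⟨h1, n1, rfl, i1⟩ <;>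
    rcases g2 with ⟨h2, rfl, z2, i2⟩ | ⟨h2, n2, rfl, i2⟩ <;>
    rcases g3 with ⟨h3, rfl, z3, i3⟩ | ⟨h3, n3, rfl, i3⟩ <;>
    rcases g4 with ⟨h4, rfl, z4, i4⟩ | ⟨h4, n4, rfl, i4⟩ <;>
    try (exfalso; omega)
    all_goals simp only [i1, i2, i3, i4]
    all_goals clear i1 i2 i3 i4
    all_goals try subst z1
    all_goals try subst z2
    all_goals try subst z3
    all_goals try subst z4
    all_goals try subst h1
    all_goals try subst h2
    all_goals try subst h3
    all_goals try subst h4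
    all_goals push_cast at *
    all_goals ring_nf at *
    all_goals field_simp
    all_goals ring
  two := by
    intro S u c d hu hcd hc hd
    have hvcd : (c : ℕ) ≠ d := fun h => hcd (Fin.ext h)
    by_cases hcu : c = u
    · subst hcu
      rw [psiH_mem (insert c S) c (Finset.mem_insert_self _ _),
        psiH_mem (insert d (insert c S)) c
          (Finset.mem_insert_of_mem (Finset.mem_insert_self _ _))]
      linear_combination psiH_exch (K := K) S c d hcd hc hd
    by_cases hdu : d = u
    · subst hdu
      rw [psiH_mem (insert d S) d (Finset.mem_insert_self _ _),
        psiH_mem (insert c (insert d S)) d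
          (Finset.mem_insert_of_mem (Finset.mem_insert_self _ _))]
      linear_combination psiH_exch (K := K) S c d hcd hc hd
    rw [psiH_insert _ _ _ hc, psiH_insert _ _ _ hd, psiH_insert _ _ _ hu, psiH_insert _ _ _ hu,
      psiH_insert2 _ _ _ _ hc hu hcu, psiH_insert2 _ _ _ _ hd hu hdu]
    unfold psiH
    generalize (1 / ((max (c : ℕ) 1 : ℕ) : K)) = a1
    generalize (1 / ((max (d : ℕ) 1 : ℕ) : K)) = a2
    generalize ∏ j ∈ S, gH K j c = P1
    generalize ∏ j ∈ S, gH K j d = P2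
    have g1 := gH_cases (K := K) S c d hc
    have g2 := gH_cases (K := K) S d c hd
    have g3 := gH_cases (K := K) S u c hu
    have g4 := gH_cases (K := K) S u d hu
    generalize gH K c d = y1 at *
    generalize gH K d c = y2 at *
    generalize gH K u c = y3 at *
    generalize gH K u d = y4 at *
    have hcu' : (c : ℕ) ≠ u := fun h => hcu (Fin.ext h)
    have hdu' : (d : ℕ) ≠ u := fun h => hdu (Fin.ext h)
    generalize chi K S c = x1 at *
    generalize chi K S d = x2 at *
    generalize (c : ℕ) = C at *
    generalize (d : ℕ) = D at *
    generalize (u : ℕ) = U at *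
    clear hc hd hu hcd hcu hdu
    rcases g1 with ⟨h1, rfl, z1, i1⟩ | ⟨h1, n1, rfl, i1⟩ <;>
    rcases g2 with ⟨h2, rfl, z2, i2⟩ | ⟨h2, n2, rfl, i2⟩ <;>
    rcases g3 with ⟨h3, rfl, z3, i3⟩ | ⟨h3, n3, rfl, i3⟩ <;>
    rcases g4 with ⟨h4, rfl, z4, i4⟩ | ⟨h4, n4, rfl, i4⟩ <;>
    try (exfalso; omega)
    all_goals simp only [i1, i2, i3, i4]
    all_goals clear i1 i2 i3 i4
    all_goals try subst z1
    all_goals try subst z2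
    all_goals try subst z3
    all_goals try subst z4
    all_goals try subst h1
    all_goals try subst h2
    all_goals try subst h3
    all_goals try subst h4
    all_goals push_cast at *
    all_goals ring_nf at *
    all_goals field_simp
    all_goals ring

/-- The rational version of `gH`. -/
lemma gH_nonneg (j c : Fin N) : 0 ≤ gH ℚ j c := by
  unfold gH
  split_ifs with h
  · norm_num
  · rcases lt_or_ge (j : ℕ) c with h1 | h1
    · have h2 : (j : ℕ) + 2 ≤ c := by omega
      have h3 : ((j : ℕ) : ℚ) + 2 ≤ ((c : ℕ) : ℚ) := by exact_mod_cast h2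
      apply div_nonneg <;> linarith
    · have h3 : ((c : ℕ) : ℚ) ≤ ((j : ℕ) : ℚ) := by exact_mod_cast h1
      apply div_nonneg_of_nonpos <;> linarith

lemma psiH_nonneg (S : Finset (Fin N)) (c : Fin N) : 0 ≤ psiH ℚ S c := by
  unfold psiH chi
  apply mul_nonneg
  · apply mul_nonneg
    · positivity
    · split_ifs <;> norm_num
  · exact Finset.prod_nonneg (fun j _ => gH_nonneg j c)

lemma psiH_cast [Algebra ℚ K] (S : Finset (Fin N)) (c : Fin N) :
    psiH K S c = algebraMap ℚ K (psiH ℚ S c) := by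
  unfold psiH chi gH
  rw [map_mul, map_mul, map_prod]
  congr 1
  · congr 1
    · rw [map_div₀, map_one, map_natCast]
    · split_ifs <;> simp
  · refine Finset.prod_congr rfl (fun j _ => ?_)
    split_ifs <;> simp

end Psi

end SS

namespace SS

section Rect

variable {K : Type*} [Field K] [CharZero K]

/-- Monotone fillings of `k` rows with values at most `h`. -/
def Fil (k h : ℕ) (v : ℕ → ℕ) : Prop :=
  (∀ t, t < k → v t ≤ h) ∧ (∀ s t, s ≤ t → t < k → v s ≤ v t)

/-- Prepend a zero row. -/
def cons0 (v : ℕ → ℕ) : ℕ → ℕ := fun t => if t = 0 then 0 else v (t - 1)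

lemma cons0_update (v : ℕ → ℕ) (t x : ℕ) :
    cons0 (Function.update v t x) = Function.update (cons0 v) (t + 1) x := by
  funext s
  by_cases h : s = t + 1
  · subst h; simp [cons0]
  · rw [Function.update_of_ne h]
    unfold cons0
    split_ifs with h0
    · rfl
    · rw [Function.update_of_ne (by omega)]

/-- Replace the first `j` rows by `1, 2, …, j`. -/
def base (j : ℕ) (v : ℕ → ℕ) : ℕ → ℕ := fun t => if t < j then t + 1 else v t

theorem rect_zero (h k : ℕ) (D : (ℕ → ℕ) → K)
    (hext : ∀ v v' : ℕ → ℕ, (∀ t, t < k → v t = v' t) → D v = D v')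
    (l1 : ∀ (v : ℕ → ℕ) (t x : ℕ), t < k → x + 2 ≤ h → (∀ s, s < t → v s ≤ x) →
      (∀ s, t < s → s < k → x + 2 ≤ v s) →
      D (Function.update v t x) + D (Function.update v t (x + 2)) =
        2 * D (Function.update v t (x + 1)))
    (l2 : ∀ (v : ℕ → ℕ) (t y : ℕ), t + 1 < k → y + 1 ≤ h → v t = y → v (t + 1) = y + 1 →
      (∀ s, s < k → v s ≤ h) →
      D (Function.update v t (y + 1)) + D (Function.update v (t + 1) y) = 2 * D v)
    (hz : ∀ v, Fil k h v → (∀ t, t < k → v t = 0 ∨ v t = h) → D v = 0) :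
    ∀ v, Fil k h v → D v = 0 := by
  induction k generalizing D with
  | zero => exact fun v hv => hz v hv (fun t ht => absurd ht (by omega))
  | succ k ih =>
    have h0 : ∀ v, Fil (k + 1) h v → v 0 = 0 → D v = 0 := by
      intro v hv hv0
      have := ih (fun u => D (cons0 u))
        (by
          intro v v' hvv
          apply hext
          intro t ht
          unfold cons0
          split_ifs with h0
          · rfl
          · exact hvv _ (by omega))
        (by
          intro v t x ht hx h1 h2
          simp only [cons0_update]
          apply l1 _ _ _ (by omega) hx
          · intro s hs
            unfold cons0
            split_ifs with h0
            · omega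
            · exact h1 _ (by omega)
          · intro s hs hs'
            unfold cons0
            rw [if_neg (by omega)]
            exact h2 _ (by omega) (by omega))
        (by
          intro v t y ht hy h1 h2 h3
          simp only [cons0_update]
          apply l2 _ _ _ (by omega) hy
          · simpa [cons0] using h1
          · simpa [cons0] using h2
          · intro s hs
            unfold cons0
            split_ifs with h0
            · omega
            · exact h3 _ (by omega))
        (by
          intro v hv h1
          apply hz
          · refine ⟨fun t ht => ?_, fun s t hst ht => ?_⟩
            · unfold cons0
              split_ifs
              · omega
              · exact hv.1 _ (by omega)
            · unfold cons0
              split_ifs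
              · omega
              · omega
              · omega
              · exact hv.2 _ _ (by omega) (by omega)
          · intro t ht
            unfold cons0
            split_ifs
            · exact Or.inl rfl
            · exact h1 _ (by omega))
        (fun t => v (t + 1))
        ⟨fun t ht => hv.1 _ (by omega), fun s t hst ht => hv.2 _ _ (by omega) (by omega)⟩
      rw [← this]
      apply hext
      intro t _
      unfold cons0
      split_ifs with h1
      · rw [h1, hv0]
      · congr 1; omega
    -- main product formula
    let P : ℕ → (ℕ → ℕ) → K := fun j v => ∏ t ∈ Finset.range j, (((v t : ℕ) : K) - ((t : ℕ) : K))
    have hP : ∀ j v, j ≤ k + 1 → Fil (k + 1) h v → P j v ≠ 0 → ∀ t, t < j → t + 1 ≤ v t := by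
      intro j v hj hv hne t
      have hfac : ∀ t, t < j → v t ≠ t := by
        intro t ht heq
        apply hne
        apply Finset.prod_eq_zero (Finset.mem_range.2 ht)
        rw [heq, sub_self]
      induction t with
      | zero => intro ht; have := hfac 0 ht; omega
      | succ t iht =>
        intro ht
        have h1 := iht (by omega)
        have h2 := hfac (t + 1) ht
        have h3 := hv.2 t (t + 1) (by omega) (by omega)
        omega
    have S : ∀ j, j ≤ k + 1 → ∀ v, Fil (k + 1) h v → D v = P j v * D (base j v) := by
      intro j
      induction j with
      | zero =>
        intro _ v _
        have : base 0 v = v := by funext t; simp [base]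
        simp [P, this]
      | succ j ihj =>
        intro hj v hv
        have ihj := ihj (by omega)
        have hPs : P (j + 1) v = P j v * (((v j : ℕ) : K) - ((j : ℕ) : K)) := by
          simp only [P]; rw [Finset.prod_range_succ]
        rw [hPs, ihj v hv]
        by_cases hne : P j v = 0
        · rw [hne]; ring
        have hge := hP j v (by omega) hv hne
        have hvj : j ≤ v j := by
          rcases Nat.eq_zero_or_pos j with h1 | h1
          · omega
          · have h2 := hge (j - 1) (by omega)
            have h3 := hv.2 (j - 1) j (by omega) (by omega)
            omega
        have hjh : j ≤ h := le_trans hvj (hv.1 j (by omega))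
        let u := base j v
        have hu1 : ∀ t, t < j → u t = t + 1 := fun t ht => by simp [u, base, ht]
        have hu2 : ∀ t, j ≤ t → u t = v t := fun t ht => by
          simp only [u, base]; rw [if_neg (by omega)]
        have hfil : ∀ x, j ≤ x → x ≤ v j → Fil (k + 1) h (Function.update u j x) := by
          intro x hx1 hx2
          have hvh := hv.1 j (by omega)
          have e1 : ∀ t, t < j → Function.update u j x t = t + 1 := fun t ht => by
            rw [Function.update_of_ne (by omega), hu1 t ht]
          have e2 : Function.update u j x j = x := Function.update_self _ _ _
          have e3 : ∀ t, j < t → Function.update u j x t = v t := fun t ht => by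
            rw [Function.update_of_ne (by omega), hu2 t (by omega)]
          refine ⟨fun t ht => ?_, fun s t hst ht => ?_⟩
          · rcases lt_trichotomy t j with h1 | h1 | h1
            · rw [e1 t h1]; omega
            · subst h1; rw [e2]; omega
            · rw [e3 t h1]; exact hv.1 t ht
          · have hvt := fun hjt : j ≤ t => hv.2 j t hjt ht
            have hvs := hv.2 s t hst ht
            rcases lt_trichotomy t j with h1 | h1 | h1
            · rw [e1 t h1, e1 s (by omega)]; omega
            · subst h1
              rcases lt_or_eq_of_le hst with h2 | h2
              · rw [e1 s h2, e2]; omega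
              · subst h2; exact le_refl _
            · rw [e3 t h1]
              have := hvt (by omega)
              rcases lt_trichotomy s j with h2 | h2 | h2
              · rw [e1 s h2]; omega
              · subst h2; rw [e2]; omega
              · rw [e3 s h2]; exact hvs
        have g0 : D (Function.update u j j) = 0 := by
          rcases Nat.eq_zero_or_pos j with h1 | h1
          · subst h1
            exact h0 _ (hfil 0 (le_refl _) hvj) (by simp)
          · obtain ⟨i, rfl⟩ : ∃ i, j = i + 1 := ⟨j - 1, by omega⟩
            have hF := hfil (i + 1) (le_refl _) hvj
            set U := Function.update u (i + 1) (i + 1) with hU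
            have hUi : U i = i + 1 := by
              rw [hU, Function.update_of_ne (by omega), hu1 i (by omega)]
            have hUi1 : U (i + 1) = i + 1 := by rw [hU]; simp
            have hUl : ∀ t, t < i → U t = t + 1 := fun t ht => by
              rw [hU, Function.update_of_ne (by omega), hu1 t (by omega)]
            have hUr : ∀ t, i + 1 ≤ t → t < k + 1 → i + 1 ≤ U t := by
              intro t ht ht'
              have := hF.2 (i + 1) t ht ht'
              omega
            let z := Function.update U i i
            have hzi : z i = i := by simp [z]
            have hzo : ∀ t, t ≠ i → z t = U t := fun t ht => by
              simp only [z]; rw [Function.update_of_ne ht]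
            have hzF : Fil (k + 1) h z := by
              refine ⟨fun t ht => ?_, fun s t hst ht => ?_⟩
              · by_cases hti : t = i
                · rw [hti, hzi]; omega
                · rw [hzo t hti]; exact hF.1 t ht
              · by_cases hti : t = i
                · subst hti
                  rw [hzi]
                  by_cases hsi : s = t
                  · rw [hsi, hzi]
                  · rw [hzo s hsi, hUl s (by omega)]; omega
                · rw [hzo t hti]
                  by_cases hsi : s = i
                  · rw [hsi, hzi]
                    have := hUr t (by omega) ht
                    omega
                  · rw [hzo s hsi]; exact hF.2 s t hst ht
            let z' := Function.update z (i + 1) i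
            have hz'i : z' i = i := by
              simp only [z']; rw [Function.update_of_ne (by omega), hzi]
            have hz'i1 : z' (i + 1) = i := by simp [z']
            have hz'o : ∀ t, t ≠ i → t ≠ i + 1 → z' t = U t := fun t ht ht' => by
              simp only [z']; rw [Function.update_of_ne ht', hzo t ht]
            have hz'F : Fil (k + 1) h z' := by
              refine ⟨fun t ht => ?_, fun s t hst ht => ?_⟩
              · by_cases hti : t = i
                · rw [hti, hz'i]; omega
                · by_cases hti' : t = i + 1
                  · rw [hti', hz'i1]; omega
                  · rw [hz'o t hti hti']; exact hF.1 t ht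
              · by_cases hti : t = i ∨ t = i + 1
                · have e : z' t = i := by rcases hti with h | h <;> rw [h] <;> assumption
                  rw [e]
                  by_cases hsi : s = i ∨ s = i + 1
                  · have e : z' s = i := by rcases hsi with h | h <;> rw [h] <;> assumption
                    omega
                  · rw [hz'o s (by omega) (by omega), hUl s (by omega)]; omega
                · rw [hz'o t (by omega) (by omega)]
                  by_cases hsi : s = i ∨ s = i + 1
                  · have e : z' s = i := by rcases hsi with h | h <;> rw [h] <;> assumption
                    have := hUr t (by omega) ht
                    omega
                  · rw [hz'o s (by omega) (by omega)]; exact hF.2 s t hst ht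
            have hDz : ∀ y, Fil (k + 1) h y → y i = i → D y = 0 := by
              intro y hy hyi
              rw [ihj y hy]
              have : P (i + 1) y = 0 := by
                apply Finset.prod_eq_zero (Finset.mem_range.2 (Nat.lt_succ_self i))
                rw [hyi, sub_self]
              rw [this, zero_mul]
            have L := l2 z i i (by omega) (by omega) hzi
              (by rw [hzo _ (by omega), hUi1]) hzF.1
            have e : Function.update z i (i + 1) = U := by
              funext t
              by_cases hti : t = i
              · rw [hti, Function.update_self, hUi]
              · rw [Function.update_of_ne hti, hzo t hti]
            rw [e, hDz z hzF hzi, hDz z' hz'F hz'i] at L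
            simpa using L
        have g1 : ∀ x, j + x ≤ v j → j + 1 ≤ v j →
            D (Function.update u j (j + x)) = (x : K) * D (Function.update u j (j + 1)) ∧
            (j + x + 1 ≤ v j → D (Function.update u j (j + x + 1)) =
              ((x : K) + 1) * D (Function.update u j (j + 1))) := by
          intro x
          induction x with
          | zero =>
            intro _ _
            refine ⟨by simp [g0], fun _ => by simp⟩
          | succ x ihx =>
            intro hx1 hx2
            obtain ⟨i1, i2⟩ := ihx (by omega) hx2
            have i2 := i2 (by omega)
            refine ⟨?_, fun hx3 => ?_⟩
            · rw [show j + (x + 1) = j + x + 1 by omega, i2]; push_cast; ring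
            · have hvh := hv.1 j (by omega)
              have L := l1 u j (j + x) (by omega) (by omega)
                (fun s hs => by rw [hu1 s hs]; omega)
                (fun s hs hs' => by
                  rw [hu2 s (by omega)]
                  have := hv.2 j s (by omega) hs'
                  omega)
              rw [i1, i2] at L
              rw [show j + (x + 1) + 1 = j + x + 2 by omega]
              push_cast
              linear_combination L
        have hbase : base (j + 1) v = Function.update u j (j + 1) := by
          funext t
          by_cases ht : t = j
          · subst ht; simp [base]
          · rw [Function.update_of_ne ht]
            simp only [u, base]
            by_cases ht' : t < j
            · rw [if_pos ht', if_pos (by omega)]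
            · rw [if_neg ht', if_neg (by omega)]
        have hself : Function.update u j (v j) = base j v := by
          rw [← hu2 j (le_refl _)]; exact Function.update_eq_self _ _
        rw [hbase, ← hself]
        rcases Nat.eq_or_lt_of_le hvj with h1 | h1
        · rw [← h1, g0]; ring
        · obtain ⟨x, hx⟩ : ∃ x, v j = j + x := ⟨v j - j, by omega⟩
          rw [hx, (g1 x (by omega) (by omega)).1]
          push_cast; ring
    intro v hv
    have hSv := S (k + 1) (le_refl _) v hv
    by_cases hne : P (k + 1) v = 0
    · rw [hSv, hne, zero_mul]
    have hge := hP (k + 1) v (le_refl _) hv hne k (by omega)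
    have hkh := hv.1 k (by omega)
    let w : ℕ → ℕ := fun _ => h
    have hwF : Fil (k + 1) h w := ⟨fun _ _ => le_refl _, fun _ _ _ _ => le_refl _⟩
    have hSw := S (k + 1) (le_refl _) w hwF
    rw [hz w hwF (fun _ _ => Or.inr rfl)] at hSw
    have hb : D (base (k + 1) w) = D (base (k + 1) v) := by
      apply hext
      intro t ht
      simp [base, ht]
    have hPw : P (k + 1) w ≠ 0 := by
      apply Finset.prod_ne_zero_iff.2
      intro t ht
      rw [Finset.mem_range] at ht
      rw [sub_ne_zero]
      simp only [w]
      intro heq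
      have := Nat.cast_injective heq
      omega
    rw [hb] at hSw
    rcases mul_eq_zero.1 hSw.symm with h1 | h1
    · exact absurd h1 hPw
    · rw [hSv, h1, mul_zero]

end Rect

end SS

namespace SS

section Uniq

variable {K : Type*} [Field K] [CharZero K]

/-- Valid row data of a natural unit interval graph. -/
def Val (n : ℕ) (r : ℕ → ℕ) : Prop :=
  (∀ k, k < n → r k ≤ k) ∧ (∀ i j, i ≤ j → j < n → r i ≤ r j)

/-- The break points of the row data. -/
def brk (n : ℕ) (r : ℕ → ℕ) : Finset ℕ :=
  (Finset.range n).filter (fun b => 0 < b ∧ ((∃ m, m < n ∧ r m = b) ∨ r (b - 1) < r b))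

lemma mem_brk {n : ℕ} {r : ℕ → ℕ} {b : ℕ} :
    b ∈ brk n r ↔ b < n ∧ 0 < b ∧ ((∃ m, m < n ∧ r m = b) ∨ r (b - 1) < r b) := by
  simp [brk]

/-- The termination measure. -/
def meas (n : ℕ) (r : ℕ → ℕ) : ℕ := ∑ b ∈ brk n r, (n - b)

/-- Fill in rows `[a, b)`. -/
def fillR (r : ℕ → ℕ) (a b lo : ℕ) (v : ℕ → ℕ) : ℕ → ℕ :=
  fun m => if a ≤ m ∧ m < b then lo + v (m - a) else r m

lemma fillR_update (r : ℕ → ℕ) (a b lo : ℕ) (v : ℕ → ℕ) (t x : ℕ) (ht : a + t < b) :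
    fillR r a b lo (Function.update v t x) =
      Function.update (fillR r a b lo v) (a + t) (lo + x) := by
  funext m
  by_cases h : m = a + t
  · subst h
    rw [Function.update_self]
    unfold fillR
    rw [if_pos ⟨by omega, ht⟩]
    simp
  · rw [Function.update_of_ne h]
    unfold fillR
    split_ifs with h1
    · rw [Function.update_of_ne (by omega)]
    · rfl

theorem uniq (n : ℕ) (D : (ℕ → ℕ) → K)
    (hext : ∀ r r' : ℕ → ℕ, (∀ k, k < n → r k = r' k) → D r = D r')
    (l1 : ∀ (r : ℕ → ℕ) (i m : ℕ), m < n → i + 2 ≤ m → r i ≤ i → r i = r (i + 1) →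
      (∀ k, k < m → r k ≤ i) → (∀ k, m < k → k < n → i + 2 ≤ r k) →
      D (Function.update r m i) + D (Function.update r m (i + 2)) =
        2 * D (Function.update r m (i + 1)))
    (l2 : ∀ (r : ℕ → ℕ) (y m : ℕ), m + 1 < n → y + 1 ≤ m → r m = y → r (m + 1) = y + 1 →
      (∀ k, k < n → r k ≠ m + 1) →
      D (Function.update r m (y + 1)) + D (Function.update r (m + 1) y) = 2 * D r)
    (hdisc : ∀ r, Val n r → ∀ m, 0 < m → m < n → r m = m → D r = 0)
    (hcomp : ∀ r, (∀ k, k < n → r k = 0) → D r = 0) :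
    ∀ r, Val n r → D r = 0 := by
  intro r
  induction hM : meas n r using Nat.strong_induction_on generalizing r with
  | _ M IH =>
  intro hr
  by_cases hdc : ∃ m, 0 < m ∧ m < n ∧ r m = m
  · obtain ⟨m, h1, h2, h3⟩ := hdc
    exact hdisc r hr m h1 h2 h3
  push Not at hdc
  by_cases hall : ∀ k, k < n → r k = 0
  · exact hcomp r hall
  push Not at hall
  have hconn : ∀ m, 0 < m → m < n → r m < m := by
    intro m h1 h2
    have := hdc m h1 h2
    have := hr.1 m h2
    omega
  -- choose s
  let T := (Finset.range n).filter (fun s => 0 < s ∧ (∃ m, m < n ∧ r m = s) ∧ r (s - 1) = r s)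
  have hT : ∀ s, s ∈ T ↔ s < n ∧ 0 < s ∧ (∃ m, m < n ∧ r m = s) ∧ r (s - 1) = r s := by
    intro s; simp [T]
  have hTne : T.Nonempty := by
    have hex : ∃ m, m < n ∧ r m ≠ 0 := hall
    obtain ⟨hm, hm0⟩ := Nat.find_spec hex
    set m := Nat.find hex with hmdef
    have hlt : ∀ k, k < m → r k = 0 := by
      intro k hk
      have := Nat.find_min hex hk
      by_contra h
      exact this ⟨by omega, h⟩
    have hmpos : 0 < m := by
      rcases Nat.eq_zero_or_pos m with h | h
      · exfalso
        have := hr.1 m hm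
        omega
      · exact h
    have hrm := hconn m hmpos hm
    refine ⟨r m, (hT _).2 ⟨by omega, by omega, ⟨m, hm, rfl⟩, ?_⟩⟩
    rw [hlt _ (by omega), hlt _ hrm]
  obtain ⟨s, hsT, hsmax⟩ := T.exists_max_image id hTne
  obtain ⟨hsn, hs0, hsval, hsflat⟩ := (hT s).1 hsT
  have hsmax : ∀ v, v < n → s < v → (∃ m, m < n ∧ r m = v) → r (v - 1) ≠ r v := by
    intro v h1 h2 h3 h4
    have := hsmax v ((hT v).2 ⟨h1, by omega, h3, h4⟩)
    simp only [id] at this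
    omega
  -- the rows
  obtain ⟨a, ⟨han, hra⟩, hamin⟩ : ∃ a, (a < n ∧ r a = s) ∧ ∀ k, k < a → ¬ (k < n ∧ r k = s) :=
    ⟨Nat.find hsval, Nat.find_spec hsval, fun k hk => Nat.find_min hsval hk⟩
  have hlow : ∀ k, k < a → r k < s := by
    intro k hk
    have h1 := hr.2 k a (by omega) han
    have h2 := hamin k hk
    have : r k ≠ s := fun h => h2 ⟨by omega, h⟩
    omega
  have hsa : s < a := by
    rcases Nat.eq_zero_or_pos a with h | h
    · have := hr.1 a han; omega
    · have := hconn a h han; omega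
  have hbex : ∃ b, a < b ∧ (n ≤ b ∨ r b ≠ s) := ⟨n, han, Or.inl (le_refl _)⟩
  obtain ⟨b, ⟨hab, hbor⟩, hbmin⟩ : ∃ b, (a < b ∧ (n ≤ b ∨ r b ≠ s)) ∧
      ∀ k, k < b → ¬ (a < k ∧ (n ≤ k ∨ r k ≠ s)) :=
    ⟨Nat.find hbex, Nat.find_spec hbex, fun k hk => Nat.find_min hbex hk⟩
  have hbn : b ≤ n := by
    by_contra h
    exact hbmin n (by omega) ⟨han, Or.inl (le_refl _)⟩
  have hmid : ∀ k, a ≤ k → k < b → r k = s := by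
    intro k h1 h2
    rcases Nat.eq_or_lt_of_le h1 with h | h
    · rw [← h, hra]
    · have := hbmin k h2
      by_contra h3
      exact this ⟨h, Or.inr h3⟩
  have hhigh : ∀ k, b ≤ k → k < n → s < r k := by
    intro k h1 h2
    have h3 := hr.2 b k h1 h2
    have h4 := hr.2 a b (by omega) (by omega)
    have h5 : r b ≠ s := by
      rcases hbor with h | h
      · omega
      · exact h
    omega
  -- lo and hi
  have hval_brk : ∀ m, m < n → 0 < r m → r m ∈ brk n r := by
    intro m h1 h2
    have := hr.1 m h1
    exact mem_brk.2 ⟨by omega, h2, Or.inl ⟨m, h1, rfl⟩⟩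
  obtain ⟨lo, hlos, hloB, hlomax⟩ : ∃ lo, lo < s ∧ (lo = 0 ∨ lo ∈ brk n r) ∧
      ∀ x ∈ brk n r, x < s → x ≤ lo := by
    by_cases hne : ((brk n r).filter (· < s)).Nonempty
    · obtain ⟨lo, h1, h2⟩ := Finset.exists_max_image _ id hne
      rw [Finset.mem_filter] at h1
      exact ⟨lo, h1.2, Or.inr h1.1, fun x hx hxs => h2 x (Finset.mem_filter.2 ⟨hx, hxs⟩)⟩
    · refine ⟨0, hs0, Or.inl rfl, fun x hx hxs => ?_⟩
      exact absurd ⟨x, Finset.mem_filter.2 ⟨hx, hxs⟩⟩ hne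
  have haB : a ∈ brk n r := by
    refine mem_brk.2 ⟨han, by omega, Or.inr ?_⟩
    rw [hra]
    exact hlow _ (by omega)
  obtain ⟨hi, hhiB, hshi, hhimin⟩ : ∃ hi, hi ∈ brk n r ∧ s < hi ∧
      ∀ x ∈ brk n r, s < x → hi ≤ x := by
    have hne : ((brk n r).filter (s < ·)).Nonempty := ⟨a, Finset.mem_filter.2 ⟨haB, hsa⟩⟩
    obtain ⟨hi, h1, h2⟩ := Finset.exists_min_image _ id hne
    rw [Finset.mem_filter] at h1
    exact ⟨hi, h1.1, h1.2, fun x hx hxs => h2 x (Finset.mem_filter.2 ⟨hx, hxs⟩)⟩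
  have hhia : hi ≤ a := hhimin a haB hsa
  have hconst : ∀ i, lo ≤ i → i + 1 < hi → r i = r (i + 1) := by
    intro i h1 h2
    by_cases his : i + 1 = s
    · rw [← his] at hsflat
      simpa using hsflat
    · have h3 := hr.2 i (i + 1) (by omega) (by omega)
      by_contra h4
      have h5 : i + 1 ∈ brk n r := mem_brk.2 ⟨by omega, by omega, Or.inr (by
        rw [Nat.add_sub_cancel]; omega)⟩
      rcases lt_or_gt_of_ne his with h | h
      · have := hlomax _ h5 h; omega
      · have := hhimin _ h5 h; omega
  have hlow' : ∀ k, k < a → r k ≤ lo := by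
    intro k hk
    rcases Nat.eq_zero_or_pos (r k) with h | h
    · omega
    · exact hlomax _ (hval_brk k (by omega) h) (hlow k hk)
  have hhigh' : ∀ k, b ≤ k → k < n → hi ≤ r k := by
    intro k h1 h2
    have h3 := hhigh k h1 h2
    exact hhimin _ (hval_brk k h2 (by omega)) h3
  have hnoval : ∀ k, k < n → ∀ v, a < v → v < b → r k ≠ v := by
    intro k hk v h1 h2 h3
    apply hsmax v (by omega) (by omega) ⟨k, hk, h3⟩
    rw [hmid (v - 1) (by omega) (by omega), hmid v (by omega) h2]
  -- evaluation of fillings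
  have f1 : ∀ v k, k < a → fillR r a b lo v k = r k := fun v k hk => by
    unfold fillR; rw [if_neg (by omega)]
  have f2 : ∀ v k, b ≤ k → fillR r a b lo v k = r k := fun v k hk => by
    unfold fillR; rw [if_neg (by omega)]
  have f3 : ∀ v k, a ≤ k → k < b → fillR r a b lo v k = lo + v (k - a) := fun v k h1 h2 => by
    unfold fillR; rw [if_pos ⟨h1, h2⟩]
  have hValF : ∀ v, Fil (b - a) (hi - lo) v → Val n (fillR r a b lo v) := by
    intro v hv
    refine ⟨fun k hk => ?_, fun i j hij hj => ?_⟩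
    · rcases lt_or_ge k a with h | h
      · rw [f1 v k h]; exact hr.1 k hk
      · rcases lt_or_ge k b with h' | h'
        · rw [f3 v k h h']
          have := hv.1 (k - a) (by omega)
          omega
        · rw [f2 v k h']; exact hr.1 k hk
    · rcases lt_or_ge j a with h | h
      · rw [f1 v j h, f1 v i (by omega)]; exact hr.2 i j hij hj
      · rcases lt_or_ge j b with h' | h'
        · rw [f3 v j h h']
          rcases lt_or_ge i a with h2 | h2
          · rw [f1 v i h2]
            have := hlow' i h2
            omega
          · rw [f3 v i h2 (by omega)]
            have := hv.2 (i - a) (j - a) (by omega) (by omega)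
            omega
        · rw [f2 v j h']
          have hh := hhigh' j h' hj
          rcases lt_or_ge i a with h2 | h2
          · rw [f1 v i h2]; exact hr.2 i j hij hj
          · rcases lt_or_ge i b with h3 | h3
            · rw [f3 v i h2 h3]
              have := hv.1 (i - a) (by omega)
              omega
            · rw [f2 v i h3]; exact hr.2 i j hij hj
  have hR : ∀ v, Fil (b - a) (hi - lo) v → D (fillR r a b lo v) = 0 := by
    apply rect_zero (hi - lo) (b - a) (fun v => D (fillR r a b lo v))
    · intro v v' hvv
      apply hext
      intro k _
      unfold fillR
      split_ifs with h
      · rw [hvv _ (by omega)]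
      · rfl
    · intro v t x ht hx h1 h2
      simp only [fillR_update r a b lo v t _ (show a + t < b by omega)]
      rw [show lo + (x + 2) = lo + x + 2 by omega, show lo + (x + 1) = lo + x + 1 by omega]
      apply l1
      · omega
      · omega
      · rw [f1 v _ (by omega)]; exact hr.1 _ (by omega)
      · rw [f1 v _ (by omega), f1 v _ (by omega)]
        exact hconst _ (by omega) (by omega)
      · intro k hk
        rcases lt_or_ge k a with h | h
        · rw [f1 v k h]; have := hlow' k h; omega
        · rw [f3 v k h (by omega)]; have := h1 (k - a) (by omega); omega
      · intro k hk hkn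
        rcases lt_or_ge k b with h | h
        · rw [f3 v k (by omega) h]
          have := h2 (k - a) (by omega) (by omega)
          omega
        · rw [f2 v k h]; have := hhigh' k h hkn; omega
    · intro v t y ht hy h1 h2 h3
      simp only [fillR_update r a b lo v t _ (show a + t < b by omega),
        fillR_update r a b lo v (t + 1) _ (show a + (t + 1) < b by omega)]
      rw [show lo + (y + 1) = lo + y + 1 by omega, show a + (t + 1) = a + t + 1 by omega]
      apply l2
      · omega
      · omega
      · rw [f3 v _ (by omega) (by omega), show a + t - a = t by omega, h1]
      · rw [f3 v _ (by omega) (by omega), show a + t + 1 - a = t + 1 by omega, h2]; omega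
      · intro k hk
        rcases lt_or_ge k a with h | h
        · rw [f1 v k h]; exact hnoval k hk _ (by omega) (by omega)
        · rcases lt_or_ge k b with h' | h'
          · rw [f3 v k h h']
            have := h3 (k - a) (by omega)
            omega
          · rw [f2 v k h']; exact hnoval k hk _ (by omega) (by omega)
    · intro v hv hext
      have hV := hValF v hv
      set r' := fillR r a b lo v with hr'
      have hv' : ∀ k, a ≤ k → k < b → r' k = lo ∨ r' k = hi := by
        intro k h1 h2
        rw [hr', f3 v k h1 h2]
        have := hext (k - a) (by omega)
        omega
      apply IH _ _ r' rfl hV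
      rw [← hM]
      -- s is not a break point any more
      have hsB : s ∈ brk n r := mem_brk.2 ⟨hsn, hs0, Or.inl hsval⟩
      have hsB' : s ∉ brk n r' := by
        rw [mem_brk]
        rintro ⟨_, _, ⟨m, hm, h1⟩ | h1⟩
        · rcases lt_or_ge m a with h | h
          · rw [hr', f1 v m h] at h1; have := hlow m h; omega
          · rcases lt_or_ge m b with h' | h'
            · have := hv' m h h'; omega
            · rw [hr', f2 v m h'] at h1; have := hhigh m h' hm; omega
        · rw [hr', f1 v _ (by omega), f1 v _ (by omega)] at h1
          omega
      have hnew : ∀ x ∈ brk n r', x ∉ brk n r → a < x ∧ x < b ∧ r' (x - 1) < r' x := by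
        intro x hx hxn
        rw [mem_brk] at hx
        obtain ⟨hxn', hx0, hx⟩ := hx
        have hnv : ∀ m, m < n → r m ≠ x := by
          intro m hm h
          apply hxn
          rw [← h]
          exact hval_brk m hm (by omega)
        have hxlo : x ≠ lo := by
          rintro rfl
          rcases hloB with h | h
          · omega
          · exact hxn h
        have hxhi : x ≠ hi := by
          rintro rfl
          exact hxn hhiB
        have hnj : ¬ (r (x - 1) < r x) := by
          intro h
          exact hxn (mem_brk.2 ⟨hxn', hx0, Or.inr h⟩)
        have hxa : x ≠ a := by
          rintro rfl; exact hxn haB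
        have hxb : x ≠ b := by
          rintro rfl
          apply hnj
          rw [hmid (x - 1) (by omega) (by omega)]
          exact hhigh x (le_refl _) hxn'
        rcases hx with ⟨m, hm, h1⟩ | h1
        · exfalso
          rcases lt_or_ge m a with h | h
          · rw [hr', f1 v m h] at h1; exact hnv m hm h1
          · rcases lt_or_ge m b with h' | h'
            · have := hv' m h h'; omega
            · rw [hr', f2 v m h'] at h1; exact hnv m hm h1
        · rcases lt_or_gt_of_ne hxa with h | h
          · exfalso
            rw [hr', f1 v _ (by omega), f1 v _ (by omega)] at h1
            exact hnj h1
          · rcases lt_or_gt_of_ne hxb with h' | h'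
            · exact ⟨h, h', h1⟩
            · exfalso
              rw [hr', f2 v _ (by omega), f2 v _ (by omega)] at h1
              exact hnj h1
      have hsum : ∑ x ∈ brk n r, (n - x) = (n - s) + ∑ x ∈ (brk n r).erase s, (n - x) :=
        (Finset.add_sum_erase _ _ hsB).symm
      unfold meas
      rw [hsum]
      by_cases hc : ∃ c, a < c ∧ c < b ∧ r' (c - 1) < r' c
      · obtain ⟨c, hc1, hc2, hc3⟩ := hc
        have hsub : brk n r' ⊆ insert c ((brk n r).erase s) := by
          intro x hx
          rw [Finset.mem_insert, Finset.mem_erase]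
          by_cases hxB : x ∈ brk n r
          · exact Or.inr ⟨fun h => hsB' (h ▸ hx), hxB⟩
          · left
            obtain ⟨h1, h2, h3⟩ := hnew x hx hxB
            have e1 := hv' x (by omega) h2
            have e2 := hv' (x - 1) (by omega) (by omega)
            have e3 := hv' c (by omega) hc2
            have e4 := hv' (c - 1) (by omega) (by omega)
            rcases lt_trichotomy x c with h | h | h
            · have := hV.2 x (c - 1) (by omega) (by omega)
              omega
            · exact h
            · have := hV.2 c (x - 1) (by omega) (by omega)
              omega
        calc ∑ x ∈ brk n r', (n - x) ≤ ∑ x ∈ insert c ((brk n r).erase s), (n - x) :=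
              Finset.sum_le_sum_of_subset hsub
          _ ≤ (n - c) + ∑ x ∈ (brk n r).erase s, (n - x) := by
              by_cases hcm : c ∈ (brk n r).erase s
              · rw [Finset.insert_eq_of_mem hcm]; omega
              · rw [Finset.sum_insert hcm]
          _ < _ := by omega
      · have hsub : brk n r' ⊆ (brk n r).erase s := by
          intro x hx
          rw [Finset.mem_erase]
          by_cases hxB : x ∈ brk n r
          · exact ⟨fun h => hsB' (h ▸ hx), hxB⟩
          · exact absurd ⟨x, hnew x hx hxB⟩ hc
        have := Finset.sum_le_sum_of_subset (f := fun x => n - x) hsub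
        omega
  have hfin : D r = D (fillR r a b lo (fun _ => s - lo)) := by
    apply hext
    intro k hk
    unfold fillR
    split_ifs with h
    · rw [hmid k h.1 h.2]; show s = lo + (s - lo); omega
    · rfl
  rw [hfin]
  exact hR _ ⟨fun _ _ => by show s - lo ≤ hi - lo; omega, fun _ _ _ _ => le_refl _⟩

end Uniq

end SS

namespace SS

section Mult

variable {K : Type*} [Field K] [CharZero K] {α : Type*} [Fintype α] [DecidableEq α]

lemma Zsum_ext (ψ : Finset α → α → K) (f : α → K) (n : ℕ) (r r' : ℕ → ℕ)
    (h : ∀ k, k < n → r k = r' k) : Zsum ψ f n r = Zsum ψ f n r' := by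
  unfold Zsum wt
  refine Finset.sum_congr rfl (fun w _ => ?_)
  congr 1
  refine Finset.prod_congr rfl (fun m _ => ?_)
  rw [h m m.2]

lemma Zsum_mul (ψ : Finset α → α → K) (f : α → K) (a b : ℕ) (r : ℕ → ℕ)
    (h : ∀ m, m < b → a ≤ r (a + m)) :
    Zsum ψ f (a + b) r = Zsum ψ f a r * Zsum ψ f b (fun m => r (a + m) - a) := by
  unfold Zsum
  rw [← (Fin.appendEquiv (α := α) a b).sum_comp, Finset.sum_mul_sum, Fintype.sum_prod_type]
  refine Finset.sum_congr rfl (fun u _ => Finset.sum_congr rfl (fun v _ => ?_))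
  simp only [Fin.appendEquiv, Equiv.coe_fn_mk]
  have h1 : ∏ m, f (Fin.append u v m) = (∏ m, f (u m)) * ∏ m, f (v m) := by
    rw [Fin.prod_univ_add]; simp
  have h2 : wt ψ r (Fin.append u v) = wt ψ r u * wt ψ (fun m => r (a + m) - a) v := by
    unfold wt
    rw [Fin.prod_univ_add]
    congr 1
    · refine Finset.prod_congr rfl (fun m _ => ?_)
      rw [Fin.append_left]
      congr 1
      ext x
      simp only [mem_seg, Fin.val_castAdd]
      constructor
      · rintro ⟨k, ⟨h1, h2⟩, h3⟩
        have hk : (k : ℕ) < a := by omega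
        refine ⟨⟨k, hk⟩, ⟨h1, h2⟩, ?_⟩
        rw [← h3, ← Fin.append_left u v]
        rfl
      · rintro ⟨k, ⟨h1, h2⟩, h3⟩
        exact ⟨Fin.castAdd b k, ⟨h1, h2⟩, by rw [Fin.append_left, h3]⟩
    · refine Finset.prod_congr rfl (fun m _ => ?_)
      rw [Fin.append_right]
      congr 1
      ext x
      have := h m m.2
      simp only [mem_seg, Fin.val_natAdd]
      constructor
      · rintro ⟨k, ⟨h1, h2⟩, h3⟩
        refine ⟨⟨k - a, by omega⟩, ⟨by simp only; omega, by simp only; omega⟩, ?_⟩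
        rw [← h3, ← Fin.append_right u v]
        congr 1
        apply Fin.ext
        simp only [Fin.val_natAdd]
        omega
      · rintro ⟨k, ⟨h1, h2⟩, h3⟩
        exact ⟨Fin.natAdd a k, ⟨by simp only [Fin.val_natAdd]; omega,
          by simp only [Fin.val_natAdd]; omega⟩, by rw [Fin.append_right, h3]⟩
  rw [h1, h2]
  ring

end Mult

section Main

variable {K : Type*} [Field K] [CharZero K] {N : ℕ}

/-- `k! e_k`. -/
def EE (x : Fin N → K) (k : ℕ) : K :=
  (k.factorial : K) * ∑ s ∈ Finset.powersetCard k (Finset.univ : Finset (Fin N)), ∏ i ∈ s, x i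

lemma EE_zero (x : Fin N → K) : EE x 0 = 1 := by simp [EE]

/-- The letter weights on Hikita's side. -/
def fH (x : Fin N → K) (j : Fin N) : K := EE x (j + 1) / EE x j

lemma card_inj (n : ℕ) (s : Finset (Fin N)) (hs : s.card = n) :
    ((Finset.univ : Finset (Fin n → Fin N)).filter
      (fun w => Function.Injective w ∧ Finset.univ.image w = s)).card = n.factorial := by
  have e : {w : Fin n → Fin N // Function.Injective w ∧ Finset.univ.image w = s} ≃
      (Fin n ≃ s) :=
    { toFun := fun w => Equiv.ofBijective
        (fun i => (⟨w.1 i, w.2.2.subset (Finset.mem_image_of_mem _ (Finset.mem_univ i))⟩ : s))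
        ⟨fun i j hij => w.2.1 (Subtype.ext_iff.1 hij), fun y => by
          obtain ⟨i, _, hi⟩ := Finset.mem_image.1 (w.2.2.symm.subset y.2)
          exact ⟨i, Subtype.ext hi⟩⟩
      invFun := fun e => ⟨fun i => (e i : Fin N), fun i j hij => e.injective (Subtype.ext hij), by
        ext y
        simp only [Finset.mem_image, Finset.mem_univ, true_and]
        constructor
        · rintro ⟨i, rfl⟩; exact (e i).2
        · intro hy; exact ⟨e.symm ⟨y, hy⟩, by simp⟩⟩
      left_inv := fun w => by ext; rfl
      right_inv := fun e => by ext; rfl }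
  rw [← Fintype.card_subtype, Fintype.card_congr e,
    Fintype.card_equiv (Fintype.equivOfCardEq (by simp [hs]))]
  simp

lemma wtX_zero (n : ℕ) (r : ℕ → ℕ) (hr : ∀ k, k < n → r k = 0) (w : Fin n → Fin N) :
    wt (psiX K) r w = if Function.Injective w then 1 else 0 := by
  unfold wt psiX
  split_ifs with h
  · apply Finset.prod_eq_one
    intro m _
    rw [if_neg]
    rw [mem_seg]
    rintro ⟨k, ⟨_, h2⟩, h3⟩
    have := h h3
    subst this
    omega
  · simp only [Function.Injective, not_forall] at h
    obtain ⟨i, j, hij, hne⟩ := h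
    have key : ∀ i j : Fin n, w i = w j → i < j →
        ∏ m : Fin n, (if w m ∈ seg w (r m) m then (0 : K) else 1) = 0 := by
      intro i j hij hlt
      apply Finset.prod_eq_zero (Finset.mem_univ j)
      rw [if_pos]
      rw [mem_seg]
      exact ⟨i, ⟨by rw [hr j j.2]; omega, hlt⟩, hij⟩
    rcases lt_or_gt_of_ne hne with h | h
    · exact key i j hij h
    · exact key j i hij.symm h

lemma ZX_complete (x : Fin N → K) (n : ℕ) (r : ℕ → ℕ) (hr : ∀ k, k < n → r k = 0) :
    Zsum (psiX K) x n r = EE x n := by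
  unfold Zsum
  simp only [wtX_zero n r hr, ite_mul, one_mul, zero_mul]
  rw [← Finset.sum_filter]
  have hmap : ∀ w ∈ (Finset.univ : Finset (Fin n → Fin N)).filter (fun w => Function.Injective w),
      Finset.univ.image w ∈ Finset.powersetCard n (Finset.univ : Finset (Fin N)) := by
    intro w hw
    rw [Finset.mem_filter] at hw
    rw [Finset.mem_powersetCard]
    exact ⟨Finset.subset_univ _, by rw [Finset.card_image_of_injective _ hw.2]; simp⟩
  rw [← Finset.sum_fiberwise_of_maps_to hmap]
  unfold EE
  rw [Finset.mul_sum]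
  refine Finset.sum_congr rfl (fun s hs => ?_)
  rw [Finset.mem_powersetCard] at hs
  rw [Finset.sum_congr rfl (g := fun _ => ∏ i ∈ s, x i)]
  · rw [Finset.sum_const, Finset.filter_filter, card_inj n s hs.2, nsmul_eq_mul]
  · intro w hw
    rw [Finset.mem_filter, Finset.mem_filter] at hw
    rw [← hw.2, Finset.prod_image (fun a _ b _ h => hw.1.2 h)]

lemma psiH_ne {S : Finset (Fin N)} {c : Fin N} (h : psiH K S c ≠ 0) :
    c ∉ S ∧ ((c : ℕ) = 0 ∨ ∃ j ∈ S, (j : ℕ) + 1 = c) := by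
  refine ⟨fun hc => h (psiH_mem S c hc), ?_⟩
  by_contra hc
  apply h
  unfold psiH chi
  rw [if_neg hc]
  ring

/-- The set of letters below `m`. -/
def lowS (N m : ℕ) : Finset (Fin N) := Finset.univ.filter (fun j => (j : ℕ) < m)

lemma lowS_prod (c t : ℕ) (htN : t ≤ N) (g : ℕ → K) :
    ∏ j ∈ lowS N t, g j = ∏ j ∈ Finset.range t, g j := by
  refine Finset.prod_bij (fun j _ => (j : ℕ)) ?_ ?_ ?_ ?_
  · intro j hj; simpa [lowS] using hj
  · intro i _ j _ h; exact Fin.ext h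
  · intro k hk
    rw [Finset.mem_range] at hk
    exact ⟨⟨k, by omega⟩, by simpa [lowS] using hk, rfl⟩
  · intro j _; rfl

lemma psiH_low (c : Fin N) : psiH K (lowS N c) c = 1 := by
  unfold psiH
  have hchi : chi K (lowS N c) c = 1 := by
    unfold chi
    rw [if_pos]
    rcases Nat.eq_zero_or_pos (c : ℕ) with h | h
    · exact Or.inl h
    · refine Or.inr ⟨⟨c - 1, by omega⟩, ?_, by simp only; omega⟩
      simp only [lowS, Finset.mem_filter, Finset.mem_univ, true_and]
      omega
  rw [hchi]
  have h1 : ∏ j ∈ lowS N c, gH K j c = ∏ j ∈ Finset.range (c : ℕ),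
      (if j + 1 = (c : ℕ) then (1 : K) else
        (((c : ℕ) : K) - (j : K)) / (((c : ℕ) : K) - 1 - (j : K))) := by
    rw [← lowS_prod (N := N) (c : ℕ) c (by omega)]
    rfl
  rw [h1]
  rcases Nat.eq_zero_or_pos (c : ℕ) with h | h
  · rw [h]; simp
  · obtain ⟨d, hd⟩ : ∃ d, (c : ℕ) = d + 1 := ⟨c - 1, by omega⟩
    rw [hd, Finset.prod_range_succ, if_pos rfl, mul_one]
    have key : ∀ t, t ≤ d → ∏ j ∈ Finset.range t, (if j + 1 = d + 1 then (1 : K) else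
        (((d + 1 : ℕ) : K) - (j : K)) / (((d + 1 : ℕ) : K) - 1 - (j : K))) =
        ((d + 1 : ℕ) : K) / (((d + 1 : ℕ) : K) - (t : K)) := by
      intro t
      induction t with
      | zero =>
        intro _
        have : ((d + 1 : ℕ) : K) ≠ 0 := by exact_mod_cast Nat.succ_ne_zero d
        simp only [Finset.range_zero, Finset.prod_empty, Nat.cast_zero, sub_zero]
        rw [div_self this]
      | succ t ih =>
        intro ht
        rw [Finset.prod_range_succ, ih (by omega), if_neg (by omega)]
        have n1 : ((d + 1 : ℕ) : K) - (t : K) ≠ 0 := by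
          rw [sub_ne_zero]; intro h; have := Nat.cast_injective h; omega
        have n2 := den_ne (K := K) t (d + 1) (by omega)
        have n3 : ((d + 1 : ℕ) : K) - ((t + 1 : ℕ) : K) ≠ 0 := by
          rw [sub_ne_zero]; intro h; have := Nat.cast_injective h; omega
        have e : ((d + 1 : ℕ) : K) - 1 - (t : K) = ((d + 1 : ℕ) : K) - ((t + 1 : ℕ) : K) := by
          push_cast; ring
        rw [e]
        field_simp
    rw [key d (le_refl _)]
    have : ((d + 1 : ℕ) : K) ≠ 0 := by exact_mod_cast Nat.succ_ne_zero d
    rw [show max (d + 1) 1 = d + 1 by omega]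
    push_cast at *
    field_simp
    ring

lemma ZH_complete (x : Fin N → K) (hE : ∀ k, k ≤ N → EE x k ≠ 0) (n : ℕ) (hn : n ≤ N)
    (r : ℕ → ℕ) (hr : ∀ k, k < n → r k = 0) :
    Zsum (psiH K) (fH x) n r = EE x n := by
  unfold Zsum
  have hseg : ∀ m, m ≤ n → seg (Fin.castLE hn) 0 m = lowS N m := by
    intro m hm
    ext c
    rw [mem_seg]
    simp only [lowS, Finset.mem_filter, Finset.mem_univ, true_and]
    constructor
    · rintro ⟨k, ⟨_, h2⟩, rfl⟩; simpa using h2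
    · intro hc; exact ⟨⟨c, by omega⟩, ⟨by omega, hc⟩, rfl⟩
  rw [Finset.sum_eq_single (Fin.castLE hn)]
  · have h1 : wt (psiH K) r (Fin.castLE hn) = 1 := by
      unfold wt
      apply Finset.prod_eq_one
      intro m _
      rw [hr m m.2, hseg m (by omega)]
      exact psiH_low (Fin.castLE hn m)
    rw [h1, one_mul]
    have h2 : ∀ t, t ≤ N → ∏ j ∈ Finset.range t, (EE x (j + 1) / EE x j) = EE x t := by
      intro t
      induction t with
      | zero => intro _; simp [EE_zero]
      | succ t ih =>
        intro ht
        rw [Finset.prod_range_succ, ih (by omega)]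
        have := hE t (by omega)
        field_simp
    rw [← h2 n hn, Finset.prod_range]
    rfl
  · intro w _ hw
    have : wt (psiH K) r w = 0 := by
      by_contra hne
      apply hw
      have hfac : ∀ m : Fin n, psiH K (seg w 0 m) (w m) ≠ 0 := by
        intro m h0
        apply hne
        unfold wt
        apply Finset.prod_eq_zero (Finset.mem_univ m)
        rw [hr m m.2, h0]
      have hval : ∀ k, ∀ hk : k < n, (w ⟨k, hk⟩ : ℕ) = k := by
        intro k
        induction k using Nat.strong_induction_on with
        | _ k ih =>
          intro hk
          have h1 := psiH_ne (hfac ⟨k, hk⟩)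
          simp only [mem_seg] at h1
          obtain ⟨h1, h2⟩ := h1
          have h3 : ¬ ((w ⟨k, hk⟩ : ℕ) < k) := by
            intro hlt
            apply h1
            refine ⟨⟨w ⟨k, hk⟩, by omega⟩, ⟨by omega, hlt⟩, ?_⟩
            apply Fin.ext
            exact ih _ hlt _
          rcases h2 with h2 | ⟨j, ⟨i, ⟨_, h4⟩, h5⟩, h6⟩
          · omega
          · have := ih i h4 i.2
            have e : (j : ℕ) = i := by rw [← h5]; exact this
            have h4' : (i : ℕ) < k := h4
            have h6' : (j : ℕ) + 1 = (w ⟨k, hk⟩ : ℕ) := h6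
            omega
      funext m
      apply Fin.ext
      exact hval m m.2
    rw [this, zero_mul]
  · intro h; exact absurd (Finset.mem_univ _) h

theorem ZX_eq_ZH (x : Fin N → K) (hE : ∀ k, k ≤ N → EE x k ≠ 0) :
    ∀ n, n ≤ N → ∀ r, Val n r → Zsum (psiX K) x n r = Zsum (psiH K) (fH x) n r := by
  intro n
  induction n using Nat.strong_induction_on with
  | _ n IH =>
  intro hn r hr
  rw [← sub_eq_zero]
  refine uniq n (fun r => Zsum (psiX K) x n r - Zsum (psiH K) (fH x) n r) ?_ ?_ ?_ ?_ ?_ r hr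
  · intro r r' h
    show _ - _ = _ - _
    rw [Zsum_ext _ _ _ _ _ h, Zsum_ext (psiH K) _ _ _ _ h]
  · intro r i m h1 h2 h3 h4 h5 h6
    have a := law_one (good_psiX (K := K) (N := N)) x n r i m h1 h2 h3 h4 h5 h6
    have b := law_one (good_psiH (K := K) (N := N)) (fH x) n r i m h1 h2 h3 h4 h5 h6
    linear_combination a - b
  · intro r y m h1 h2 h3 h4 h5
    have a := law_two (good_psiX (K := K) (N := N)) x n r y m h1 h2 h3 h4 h5
    have b := law_two (good_psiH (K := K) (N := N)) (fH x) n r y m h1 h2 h3 h4 h5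
    linear_combination a - b
  · intro r hr m h0 hm hrm
    obtain ⟨b, rfl⟩ : ∃ b, n = m + b := ⟨n - m, by omega⟩
    have hge : ∀ k, k < b → m ≤ r (m + k) := by
      intro k hk
      have := hr.2 m (m + k) (by omega) (by omega)
      omega
    show _ - _ = _
    rw [Zsum_mul _ _ m b r hge, Zsum_mul _ _ m b r hge]
    rw [IH m (by omega) (by omega) r ⟨fun k hk => hr.1 k (by omega),
      fun i j hij hj => hr.2 i j hij (by omega)⟩]
    rw [IH b (by omega) (by omega) _ ⟨fun k hk => by
        have := hr.1 (m + k) (by omega)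
        show r (m + k) - m ≤ k
        omega,
      fun i j hij hj => by
        have := hr.2 (m + i) (m + j) (by omega) (by omega)
        show r (m + i) - m ≤ r (m + j) - m
        omega⟩]
    ring
  · intro r h
    show _ - _ = _
    rw [ZX_complete x n r h, ZH_complete x hE n hn r h, sub_self]

/-- The support lemma: a word of nonzero weight contributes a product of `E_k`. -/
theorem support_word (x : Fin N → K) (hE : ∀ k, k ≤ N → EE x k ≠ 0) (n : ℕ)
    (r : ℕ → ℕ) (w : Fin n → Fin N) (hw : wt (psiH K) r w ≠ 0) :
    ∃ s : Multiset ℕ, (∀ k ∈ s, 0 < k) ∧ s.sum = n ∧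
      (s.map (EE x)).prod = ∏ m, fH x (w m) := by
  have hfac : ∀ m : Fin n, psiH K (seg w (r m) m) (w m) ≠ 0 := by
    intro m h0
    apply hw
    unfold wt
    exact Finset.prod_eq_zero (Finset.mem_univ m) h0
  have main : ∀ t, t ≤ n → ∃ s : Multiset ℕ, (∀ k ∈ s, 0 < k) ∧ s.sum = t ∧
      (s.map (EE x)).prod = ∏ m ∈ Finset.univ.filter (fun m : Fin n => (m : ℕ) < t), fH x (w m) ∧
      (∀ c : ℕ, (∃ k : Fin n, (k : ℕ) < t ∧ (w k : ℕ) = c ∧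
        ∀ k' : Fin n, k < k' → (k' : ℕ) < t → (w k' : ℕ) ≠ c + 1) → c + 1 ∈ s) := by
    intro t
    induction t with
    | zero =>
      intro _
      exact ⟨0, by simp, by simp, by simp, fun c ⟨k, h, _⟩ => absurd h (by omega)⟩
    | succ t ih =>
      intro ht
      obtain ⟨s, hpos, hsum, hprod, hlast⟩ := ih (by omega)
      let T : Fin n := ⟨t, by omega⟩
      have hfil : Finset.univ.filter (fun m : Fin n => (m : ℕ) < t + 1) =
          insert T (Finset.univ.filter (fun m : Fin n => (m : ℕ) < t)) := by
        ext m
        simp only [Finset.mem_filter, Finset.mem_univ, true_and, Finset.mem_insert, T, Fin.ext_iff]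
        omega
      have hTn : T ∉ Finset.univ.filter (fun m : Fin n => (m : ℕ) < t) := by simp [T]
      rw [hfil, Finset.prod_insert hTn]
      obtain ⟨hn1, hn2⟩ := psiH_ne (hfac T)
      have hlt : ∀ k : Fin n, (k : ℕ) < t + 1 → k ≠ T → (k : ℕ) < t := by
        intro k hk hkT
        have : (k : ℕ) ≠ t := fun h => hkT (Fin.ext h)
        omega
      rcases Nat.eq_zero_or_pos (w T : ℕ) with h0 | h0
      · refine ⟨1 ::ₘ s, ?_, ?_, ?_, ?_⟩
        · intro k hk
          rw [Multiset.mem_cons] at hk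
          rcases hk with rfl | hk
          · omega
          · exact hpos k hk
        · rw [Multiset.sum_cons, hsum]; omega
        · rw [Multiset.map_cons, Multiset.prod_cons, hprod]
          congr 1
          unfold fH
          rw [h0, EE_zero]
          simp
        · rintro c ⟨k, hk1, hk2, hk3⟩
          rw [Multiset.mem_cons]
          by_cases hkT : k = T
          · left; rw [hkT] at hk2; omega
          · right
            exact hlast c ⟨k, hlt k hk1 hkT, hk2, fun k' h1 h2 => hk3 k' h1 (by omega)⟩
      · obtain ⟨c, hc⟩ : ∃ c, (w T : ℕ) = c + 1 := ⟨(w T : ℕ) - 1, by omega⟩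
        have hcs : c + 1 ∈ s := by
          rcases hn2 with h | ⟨j, hj, hj2⟩
          · omega
          · rw [mem_seg] at hj
            obtain ⟨k, ⟨hk1, hk2⟩, hk3⟩ := hj
            refine hlast c ⟨k, hk2, by rw [hk3]; omega, ?_⟩
            intro k' h1 h2 h3
            apply hn1
            rw [mem_seg]
            refine ⟨k', ⟨?_, h2⟩, Fin.ext (by omega)⟩
            have h1' : (k : ℕ) < k' := h1
            omega
        have hs := Multiset.cons_erase hcs
        refine ⟨(c + 2) ::ₘ s.erase (c + 1), ?_, ?_, ?_, ?_⟩
        · intro k hk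
          rw [Multiset.mem_cons] at hk
          rcases hk with rfl | hk
          · omega
          · exact hpos k (Multiset.mem_of_mem_erase hk)
        · rw [← hs, Multiset.sum_cons] at hsum
          rw [Multiset.sum_cons]; omega
        · rw [← hprod]
          conv_rhs => rw [← hs]
          rw [Multiset.map_cons, Multiset.prod_cons, Multiset.map_cons, Multiset.prod_cons]
          unfold fH
          rw [hc]
          have := hE (c + 1) (by have := (w T).2; omega)
          field_simp
        · rintro c' ⟨k, hk1, hk2, hk3⟩
          rw [Multiset.mem_cons]
          by_cases hkT : k = T
          · left; rw [hkT] at hk2; omega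
          · right
            have h1 := hlast c' ⟨k, hlt k hk1 hkT, hk2, fun k' h1 h2 => hk3 k' h1 (by omega)⟩
            have hkt : k < T := hlt k hk1 hkT
            have h2 := hk3 T hkt (by simp [T])
            exact (Multiset.mem_erase_of_ne (by omega)).2 h1
  obtain ⟨s, h1, h2, h3, _⟩ := main n (le_refl _)
  refine ⟨s, h1, h2, ?_⟩
  rw [h3]
  congr 1
  ext m
  simp

end Main

end SS

namespace SS

section LinIndep

/-- Exponent vectors attached to partitions. -/
noncomputable def expo (N : ℕ) {n : ℕ} (q : Nat.Partition n) : Fin N →₀ ℕ :=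
  ∑ i : Fin N, Finsupp.single i (q.parts.count ((i : ℕ) + 1))

lemma expo_apply (N : ℕ) {n : ℕ} (q : Nat.Partition n) (i : Fin N) :
    expo N q i = q.parts.count ((i : ℕ) + 1) := by
  unfold expo
  rw [Finsupp.finsetSum_apply]
  rw [Finset.sum_eq_single i]
  · simp
  · intro j _ hj; rw [Finsupp.single_apply, if_neg hj]
  · intro h; exact absurd (Finset.mem_univ _) h

lemma part_le {n : ℕ} (q : Nat.Partition n) {k : ℕ} (hk : k ∈ q.parts) : k ≤ n := by
  have h := Multiset.single_le_sum (fun x _ => Nat.zero_le x) k hk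
  rwa [q.parts_sum] at h

lemma expo_inj (N n : ℕ) (hN : n ≤ N) : Function.Injective (expo N : Nat.Partition n → _) := by
  intro q q' h
  apply Nat.Partition.ext
  ext k
  by_cases hk : 1 ≤ k ∧ k ≤ N
  · have := DFunLike.congr_fun h (⟨k - 1, by omega⟩ : Fin N)
    rw [expo_apply, expo_apply] at this
    simpa [Nat.sub_add_cancel hk.1] using this
  · have hz : ∀ q : Nat.Partition n, q.parts.count k = 0 := by
      intro q
      rw [Multiset.count_eq_zero]
      intro hm
      have h1 := part_le q hm
      have h2 := q.parts_pos hm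
      omega
    rw [hz, hz]

lemma eProd_eq_aeval (N : ℕ) (R : Type) [CommRing R] {n : ℕ} (hN : n ≤ N)
    (q : Nat.Partition n) (b : R) :
    C b * eProd N R q =
      aeval (fun i : Fin N => esymm (Fin N) R ((i : ℕ) + 1)) (monomial (expo N q) b) := by
  rw [aeval_monomial]
  congr 1
  unfold eProd
  rw [Finsupp.prod_fintype _ _ (by simp)]
  simp only [expo_apply]
  rw [Finset.prod_multiset_map_count]
  rw [Finset.prod_subset (s₁ := q.parts.toFinset) (s₂ := Finset.Icc 1 N)]
  · rw [← Finset.prod_image (s := Finset.univ) (g := fun i : Fin N => (i : ℕ) + 1)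
      (f := fun k => esymm (Fin N) R k ^ q.parts.count k)]
    · refine Finset.prod_congr ?_ (fun _ _ => rfl)
      symm
      ext k
      simp only [Finset.mem_image, Finset.mem_univ, true_and, Finset.mem_Icc]
      constructor
      · rintro ⟨i, rfl⟩; have := i.2; omega
      · rintro ⟨h1, h2⟩; exact ⟨⟨k - 1, by omega⟩, by simp only; omega⟩
    · intro i _ j _ h; exact Fin.ext (by simpa using h)
  · intro k hk
    rw [Multiset.mem_toFinset] at hk
    have h1 := part_le q hk
    have h2 := q.parts_pos hk
    rw [Finset.mem_Icc]; omega
  · intro k _ hk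
    rw [Multiset.mem_toFinset] at hk
    rw [Multiset.count_eq_zero_of_notMem hk, pow_zero]

lemma eProd_indep (N : ℕ) (R : Type) [CommRing R] {n : ℕ} (hN : n ≤ N)
    (b : Nat.Partition n → R) (h : ∑ q, C (b q) * eProd N R q = 0) : ∀ q, b q = 0 := by
  simp only [eProd_eq_aeval N R hN] at h
  rw [← map_sum] at h
  have hinj := esymmAlgHom_fin_injective R (le_refl N)
  have hz : ∑ q : Nat.Partition n, monomial (expo N q) (b q) = 0 := by
    apply hinj
    apply Subtype.ext
    rw [esymmAlgHom_apply, h, map_zero]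
    rfl
  intro q
  have := congrArg (coeff (expo N q)) hz
  rw [coeff_sum, Finset.sum_eq_single q] at this
  · simpa using this
  · intro q' _ hq'
    rw [coeff_monomial, if_neg (fun h => hq' (expo_inj N n hN h))]
  · intro h; exact absurd (Finset.mem_univ _) h

end LinIndep

section Graph

/-- The row data of a natural unit interval graph. -/
noncomputable def rowG {n : ℕ} (G : SimpleGraph (Fin n)) (m : ℕ) : ℕ :=
  if hm : m < n then
    Nat.find (p := fun j => ∀ i : Fin n, j ≤ (i : ℕ) → (i : ℕ) < m → G.Adj i ⟨m, hm⟩)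
      ⟨m, fun i h1 h2 => absurd h2 (by omega)⟩
  else 0

lemma rowG_spec {n : ℕ} (G : SimpleGraph (Fin n)) (m i : Fin n) (h1 : rowG G m ≤ i)
    (h2 : i < m) : G.Adj i m := by
  have hex : ∃ j, ∀ i : Fin n, j ≤ (i : ℕ) → (i : ℕ) < (m : ℕ) → G.Adj i ⟨m, m.2⟩ :=
    ⟨m, fun i h1 h2 => absurd h2 (by omega)⟩
  have : rowG G m = Nat.find hex := by
    unfold rowG; rw [dif_pos m.2]
  rw [this] at h1
  exact Nat.find_spec hex i h1 h2

lemma rowG_le {n : ℕ} (G : SimpleGraph (Fin n)) (m : Fin n) (j : ℕ)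
    (h : ∀ i : Fin n, j ≤ (i : ℕ) → i < m → G.Adj i m) : rowG G m ≤ j := by
  have hex : ∃ j, ∀ i : Fin n, j ≤ (i : ℕ) → (i : ℕ) < (m : ℕ) → G.Adj i ⟨m, m.2⟩ :=
    ⟨m, fun i h1 h2 => absurd h2 (by omega)⟩
  have : rowG G m = Nat.find hex := by
    unfold rowG; rw [dif_pos m.2]
  rw [this]
  exact Nat.find_min' hex h

lemma rowG_adj {n : ℕ} (G : SimpleGraph (Fin n)) (hG : IsNUIG G) (m i : Fin n) (h2 : i < m) :
    rowG G m ≤ i ↔ G.Adj i m := by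
  refine ⟨fun h1 => rowG_spec G m i h1 h2, fun h => rowG_le G m i (fun j hj hjm => ?_)⟩
  rcases Nat.eq_or_lt_of_le hj with h1 | h1
  · have : i = j := Fin.ext h1
    rwa [← this]
  · exact (hG i j m h1 hjm h).2

lemma rowG_val {n : ℕ} (G : SimpleGraph (Fin n)) (hG : IsNUIG G) : Val n (rowG G) := by
  constructor
  · intro k hk
    exact rowG_le G ⟨k, hk⟩ k (fun i h1 h2 => absurd (show (i : ℕ) < k from h2) (by omega))
  · intro i j hij hj
    rcases Nat.eq_or_lt_of_le hij with h | h
    · rw [h]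
    · refine rowG_le G ⟨i, by omega⟩ _ (fun k hk hki => ?_)
      have hki' : (k : ℕ) < i := hki
      have := rowG_spec G ⟨j, hj⟩ k hk (show (k : ℕ) < j by omega)
      exact (hG k ⟨i, by omega⟩ ⟨j, hj⟩ hki h this).1

lemma wtX_graph {K : Type*} [Field K] {n N : ℕ} (G : SimpleGraph (Fin n)) (hG : IsNUIG G)
    (κ : Fin n → Fin N) : wt (psiX K) (rowG G) κ = if IsProper G κ then 1 else 0 := by
  unfold wt psiX
  split_ifs with h
  · apply Finset.prod_eq_one
    intro m _
    rw [if_neg]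
    rw [mem_seg]
    rintro ⟨k, ⟨h1, h2⟩, h3⟩
    exact h k m (rowG_spec G m k h1 h2) h3
  · unfold IsProper at h
    push Not at h
    obtain ⟨i, j, hij, he⟩ := h
    have key : ∀ i j : Fin n, κ i = κ j → i < j → G.Adj i j →
        ∏ m : Fin n, (if κ m ∈ seg κ (rowG G m) m then (0 : K) else 1) = 0 := by
      intro i j hij hlt hadj
      apply Finset.prod_eq_zero (Finset.mem_univ j)
      rw [if_pos]
      rw [mem_seg]
      exact ⟨i, ⟨(rowG_adj G hG j i hlt).2 hadj, hlt⟩, hij⟩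
    rcases lt_or_gt_of_ne hij.ne with h | h
    · exact key i j he h hij
    · exact key j i he.symm h hij.symm

end Graph

section Final

variable {N : ℕ}

/-- The field of rational functions. -/
abbrev KK (N : ℕ) := FractionRing (MvPolynomial (Fin N) ℚ)

instance charZeroKK : CharZero (KK N) := algebraRat.charZero _

/-- The variables in the fraction field. -/
noncomputable def xK (N : ℕ) (i : Fin N) : KK N := algebraMap (MvPolynomial (Fin N) ℚ) (KK N) (X i)

lemma EE_xK (k : ℕ) : EE (xK N) k = algebraMap (MvPolynomial (Fin N) ℚ) (KK N)
    (C (k.factorial : ℚ) * esymm (Fin N) ℚ k) := by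
  unfold EE esymm xK
  rw [map_mul, map_sum]
  simp only [map_prod]
  congr 1
  simp

lemma EE_ne (k : ℕ) (hk : k ≤ N) : EE (xK N) k ≠ 0 := by
  rw [EE_xK]
  intro h
  rw [map_eq_zero_iff _ (IsFractionRing.injective (MvPolynomial (Fin N) ℚ) (KK N))] at h
  have h2 := congrArg (eval (fun _ => (1 : ℚ))) h
  rw [map_mul, eval_C, map_zero] at h2
  unfold esymm at h2
  rw [map_sum] at h2
  simp only [map_prod, eval_X, Finset.prod_const_one, Finset.sum_const,
    Finset.card_powersetCard, Finset.card_univ, Fintype.card_fin, nsmul_eq_mul, mul_one] at h2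
  have h3 : ((k.factorial * N.choose k : ℕ) : ℚ) = 0 := by push_cast; exact h2
  have h4 : k.factorial * N.choose k = 0 := by exact_mod_cast h3
  have h5 := Nat.factorial_pos k
  have h6 := Nat.choose_pos hk
  have := Nat.mul_pos h5 h6
  omega

lemma wtH_cast {n : ℕ} (r : ℕ → ℕ) (w : Fin n → Fin N) :
    wt (psiH (KK N)) r w = algebraMap ℚ (KK N) (wt (psiH ℚ) r w) := by
  unfold wt
  rw [map_prod]
  exact Finset.prod_congr rfl (fun m _ => psiH_cast _ _)

lemma word_term {n : ℕ} (r : ℕ → ℕ) (w : Fin n → Fin N) :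
    ∃ (a : ℚ) (q : Nat.Partition n), 0 ≤ a ∧
      wt (psiH (KK N)) r w * ∏ m, fH (xK N) (w m) =
        algebraMap (MvPolynomial (Fin N) ℚ) (KK N) (C a * eProd N ℚ q) := by
  by_cases h : wt (psiH (KK N)) r w = 0
  · exact ⟨0, Nat.Partition.indiscrete n, le_refl _, by rw [h]; simp⟩
  · obtain ⟨s, h1, h2, h3⟩ := support_word (xK N) EE_ne n r w h
    refine ⟨wt (psiH ℚ) r w * (s.map (fun k => (k.factorial : ℚ))).prod,
      ⟨s, fun {i} hi => h1 i hi, h2⟩, ?_, ?_⟩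
    · apply mul_nonneg
      · unfold wt
        exact Finset.prod_nonneg (fun m _ => psiH_nonneg _ _)
      · apply Multiset.prod_nonneg
        intro a ha
        rw [Multiset.mem_map] at ha
        obtain ⟨k, _, rfl⟩ := ha
        positivity
    · rw [← h3, wtH_cast, C_mul, mul_assoc, map_mul]
      rw [← MvPolynomial.algebraMap_eq, ← IsScalarTower.algebraMap_apply]
      congr 1
      unfold eProd
      simp only
      have : (s.map (EE (xK N))) = (s.map (fun k => C (k.factorial : ℚ) * esymm (Fin N) ℚ k)).map
          (algebraMap (MvPolynomial (Fin N) ℚ) (KK N)) := by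
        rw [Multiset.map_map]
        exact Multiset.map_congr rfl (fun k _ => EE_xK k)
      rw [this, ← map_multiset_prod, Multiset.prod_map_mul]
      congr 2
      rw [map_multiset_prod, Multiset.map_map]
      rfl

theorem q1_part (n : ℕ) (hN : n ≤ N) (G : SimpleGraph (Fin n)) (hG : IsNUIG G)
    (c : Nat.Partition n → ℤ)
    (h : chromSym n N G = ∑ q : Nat.Partition n, C (c q) * eProd N ℤ q)
    (p : Nat.Partition n) : 0 ≤ c p := by
  choose a q ha hq using fun w : Fin n → Fin N => word_term (N := N) (rowG G) w
  have hinj := IsFractionRing.injective (MvPolynomial (Fin N) ℚ) (KK N)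
  have hX : map (Int.castRingHom ℚ) (chromSym n N G) =
      ∑ w : Fin n → Fin N, C (a w) * eProd N ℚ (q w) := by
    apply hinj
    rw [map_sum]
    simp only [← hq]
    have := ZX_eq_ZH (xK N) EE_ne n hN (rowG G) (rowG_val G hG)
    unfold Zsum at this
    rw [← this]
    unfold chromSym
    rw [map_sum, map_sum]
    refine Finset.sum_congr rfl (fun κ _ => ?_)
    rw [wtX_graph G hG]
    split_ifs with hp
    · simp [xK]
    · simp
  have hY : map (Int.castRingHom ℚ) (chromSym n N G) =
      ∑ p : Nat.Partition n, C ((c p : ℤ) : ℚ) * eProd N ℚ p := by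
    rw [h, map_sum]
    refine Finset.sum_congr rfl (fun p _ => ?_)
    rw [map_mul, map_C]
    congr 1
    unfold eProd
    rw [map_multiset_prod, Multiset.map_map]
    congr 1
    exact Multiset.map_congr rfl (fun k _ => map_esymm _ _ _ _)
  have hZ : ∑ w : Fin n → Fin N, C (a w) * eProd N ℚ (q w) =
      ∑ p : Nat.Partition n, C (∑ w ∈ Finset.univ.filter (fun w => q w = p), a w) * eProd N ℚ p := by
    rw [← Finset.sum_fiberwise (s := Finset.univ) (g := q)]
    refine Finset.sum_congr rfl (fun p _ => ?_)
    rw [map_sum, Finset.sum_mul]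
    refine Finset.sum_congr rfl (fun w hw => ?_)
    rw [(Finset.mem_filter.1 hw).2]
  have hD : ∑ p : Nat.Partition n, C (((c p : ℤ) : ℚ) -
      ∑ w ∈ Finset.univ.filter (fun w => q w = p), a w) * eProd N ℚ p = 0 := by
    simp only [C_sub, sub_mul]
    rw [Finset.sum_sub_distrib, ← hY, ← hZ, hX, sub_self]
  have := eProd_indep N ℚ hN _ hD p
  have hc : ((c p : ℤ) : ℚ) = ∑ w ∈ Finset.univ.filter (fun w => q w = p), a w := by linarith
  have : (0 : ℚ) ≤ ((c p : ℤ) : ℚ) := by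
    rw [hc]; exact Finset.sum_nonneg (fun w _ => ha w)
  exact_mod_cast this

end Final

end SS

namespace SS

section Coef

variable {ι : Type} [Fintype ι] {N : ℕ}

/-- The initial segment `{0,…,k-1}` of `Fin N`. -/
noncomputable def ini (N k : ℕ) : Finset (Fin N) := Finset.univ.filter (fun j => (j : ℕ) < k)

lemma mem_ini {k : ℕ} {j : Fin N} : j ∈ ini N k ↔ (j : ℕ) < k := by simp [ini]

lemma card_ini {k : ℕ} (hk : k ≤ N) : (ini N k).card = k := by
  unfold ini
  rw [Fin.card_filter_val_lt]
  omega

/-- Families of subsets of given sizes covering every point `j` exactly `ν j` times. -/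
noncomputable def fam (N : ℕ) (b : ι → ℕ) (ν : Fin N → ℕ) : Finset (ι → Finset (Fin N)) :=
  (Fintype.piFinset fun i => Finset.powersetCard (b i) Finset.univ).filter
    (fun f => ∀ j, (Finset.univ.filter (fun i => j ∈ f i)).card = ν j)

lemma mem_fam {b : ι → ℕ} {ν : Fin N → ℕ} {f : ι → Finset (Fin N)} :
    f ∈ fam N b ν ↔ (∀ i, (f i).card = b i) ∧
      ∀ j, (Finset.univ.filter (fun i => j ∈ f i)).card = ν j := by
  unfold fam
  rw [Finset.mem_filter, Fintype.mem_piFinset]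
  simp [Finset.mem_powersetCard]

lemma coeff_prod_esymm (R : Type) [CommRing R] (b : ι → ℕ) (ν : Fin N → ℕ) :
    coeff (Finsupp.equivFunOnFinite.symm ν) (∏ i, esymm (Fin N) R (b i)) =
      ((fam N b ν).card : R) := by
  simp only [esymm_eq_sum_monomial]
  rw [Finset.prod_univ_sum, coeff_sum]
  simp only [← monomial_sum_one, coeff_monomial]
  rw [Finset.sum_boole]
  unfold fam
  congr 2
  apply Finset.filter_congr
  intro f _
  rw [DFunLike.ext_iff]
  apply forall_congr'
  intro j
  have : (∑ i, ∑ j ∈ f i, Finsupp.single j 1 : Fin N →₀ ℕ) j =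
      (Finset.univ.filter (fun i => j ∈ f i)).card := by
    rw [Finsupp.finsetSum_apply, Finset.card_filter]
    refine Finset.sum_congr rfl (fun i _ => ?_)
    rw [Finsupp.finsetSum_apply]
    simp [Finsupp.single_apply]
  rw [this]
  rfl

/-- Column lengths. -/
noncomputable def cjb (b : ι → ℕ) (j : ℕ) : ℕ := (Finset.univ.filter (fun i => j < b i)).card

/-- Number of cells in the first `k` columns. -/
def csb (b : ι → ℕ) (k : ℕ) : ℕ := ∑ i, min (b i) k

lemma csb_range (b : ι → ℕ) (k : ℕ) : csb b k = ∑ j ∈ Finset.range k, cjb b j := by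
  unfold csb cjb
  simp only [Finset.card_filter]
  rw [Finset.sum_comm]
  refine Finset.sum_congr rfl (fun i _ => ?_)
  rw [← Finset.card_filter]
  have : (Finset.range k).filter (fun j => j < b i) = Finset.range (min (b i) k) := by
    ext j; simp; omega
  rw [this, Finset.card_range]

lemma csb_ini (b : ι → ℕ) (k : ℕ) (hk : k ≤ N) : ∑ j ∈ ini N k, cjb b j = csb b k := by
  unfold csb cjb
  simp only [Finset.card_filter]
  rw [Finset.sum_comm]
  refine Finset.sum_congr rfl (fun i _ => ?_)
  rw [← Finset.card_filter]
  have : (ini N k).filter (fun j : Fin N => (j : ℕ) < b i) = ini N (min (b i) k) := by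
    ext j; simp [mem_ini]; omega
  rw [this, card_ini (by omega)]

lemma fam_sum {b : ι → ℕ} {ν : Fin N → ℕ} {f : ι → Finset (Fin N)} (hf : f ∈ fam N b ν)
    (S : Finset (Fin N)) : ∑ j ∈ S, ν j = ∑ i, (S ∩ f i).card := by
  rw [mem_fam] at hf
  simp only [← hf.2, Finset.card_filter]
  rw [Finset.sum_comm]
  refine Finset.sum_congr rfl (fun i _ => ?_)
  rw [← Finset.card_filter, Finset.filter_mem_eq_inter]

lemma fam_term_le {b : ι → ℕ} {ν : Fin N → ℕ} {f : ι → Finset (Fin N)} (hf : f ∈ fam N b ν)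
    {k : ℕ} (hk : k ≤ N) (i : ι) : (ini N k ∩ f i).card ≤ min (b i) k := by
  rw [mem_fam] at hf
  apply le_min
  · rw [← hf.1 i]; exact Finset.card_le_card Finset.inter_subset_right
  · have := Finset.card_le_card (Finset.inter_subset_left (s₁ := ini N k) (s₂ := f i))
    rwa [card_ini hk] at this

lemma fam_dom {κ : Type} [Fintype κ] {b : ι → ℕ} {b' : κ → ℕ} {f : ι → Finset (Fin N)}
    (hf : f ∈ fam N b (fun j => cjb b' j)) {k : ℕ} (hk : k ≤ N) : csb b' k ≤ csb b k := by
  rw [← csb_ini b' k hk, fam_sum hf]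
  exact Finset.sum_le_sum (fun i _ => fam_term_le hf hk i)

lemma fam_eq {κ : Type} [Fintype κ] {b : ι → ℕ} {b' : κ → ℕ} {f : ι → Finset (Fin N)}
    (hf : f ∈ fam N b (fun j => cjb b' j)) {k : ℕ} (hk : k ≤ N) (he : csb b' k = csb b k)
    (i : ι) : (ini N k ∩ f i).card = min (b i) k := by
  have h1 : ∑ i, (ini N k ∩ f i).card = ∑ i, min (b i) k := by
    rw [← fam_sum hf, csb_ini b' k hk, he]; rfl
  exact (Finset.sum_eq_sum_iff_of_le (fun i _ => fam_term_le hf hk i)).1 h1 i (Finset.mem_univ _)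

lemma fam_forced {κ : Type} [Fintype κ] {b : ι → ℕ} {b' : κ → ℕ} {f : ι → Finset (Fin N)}
    (hf : f ∈ fam N b (fun j => cjb b' j)) (i : ι) (hk : b i ≤ N)
    (he : csb b' (b i) = csb b (b i)) : f i = ini N (b i) := by
  have h := fam_eq hf hk he i
  rw [min_self] at h
  have h1 := (mem_fam.1 hf).1 i
  have h2 : ini N (b i) ∩ f i = f i :=
    Finset.eq_of_subset_of_card_le Finset.inter_subset_right (by omega)
  have h3 : ini N (b i) ∩ f i = ini N (b i) :=
    Finset.eq_of_subset_of_card_le Finset.inter_subset_left (by rw [card_ini hk]; omega)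
  rw [← h2, h3]

lemma fam_self (b : ι → ℕ) (hb : ∀ i, b i ≤ N) : (fam N b (fun j => cjb b j)).card = 1 := by
  rw [Finset.card_eq_one]
  refine ⟨fun i => ini N (b i), ?_⟩
  ext f
  rw [Finset.mem_singleton]
  constructor
  · intro hf
    funext i
    exact fam_forced hf i (hb i) rfl
  · rintro rfl
    rw [mem_fam]
    refine ⟨fun i => card_ini (hb i), fun j => ?_⟩
    simp only [mem_ini]
    rfl

lemma fam_bound {κ : Type} [Fintype κ] (b : ι → ℕ) (b' : κ → ℕ) (k : ℕ) (hk1 : k ≤ N)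
    (h0 : 1 ≤ k)
    (he : ∀ k' < k, csb b' k' = csb b k') (h2 : cjb b (k - 1) = 2) (i1 : ι) (hi1 : b i1 = k)
    (h4 : ∀ j, 4 ≤ j → cjb b' j = 0) : (fam N b (fun j => cjb b' j)).card ≤ 5 - k := by
  have hc : ((Finset.Ico (k - 1) 4).image
      (fun x => Finset.univ.filter (fun j : Fin N => (j : ℕ) < k - 1 ∨ (j : ℕ) = x))).card
      ≤ 5 - k := by
    refine Finset.card_image_le.trans ?_
    rw [Nat.card_Ico]; omega
  refine le_trans (Finset.card_le_card_of_injOn (fun f => f i1) ?_ ?_) hc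
  · intro f hf
    rw [Finset.mem_coe] at hf
    rw [Finset.mem_coe, Finset.mem_image]
    have e1 := fam_eq hf (k := k - 1) (by omega) (he _ (by omega)) i1
    have e2 := (mem_fam.1 hf).1 i1
    have e3 : ini N (k - 1) ∩ f i1 = ini N (k - 1) :=
      Finset.eq_of_subset_of_card_le Finset.inter_subset_left (by
        rw [card_ini (by omega)]; omega)
    have e4 : (f i1 \ ini N (k - 1)).card = 1 := by
      rw [Finset.card_sdiff, e1]; omega
    obtain ⟨x, hx⟩ := Finset.card_eq_one.1 e4
    have hx1 : x ∈ f i1 ∧ x ∉ ini N (k - 1) := by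
      rw [← Finset.mem_sdiff, hx]; exact Finset.mem_singleton_self _
    rw [mem_ini] at hx1
    refine ⟨x, ?_, ?_⟩
    · rw [Finset.mem_Ico]
      refine ⟨by omega, ?_⟩
      by_contra hlt
      have e5 := (mem_fam.1 hf).2 x
      rw [h4 x (by omega), Finset.card_eq_zero] at e5
      have : i1 ∈ Finset.univ.filter (fun i => x ∈ f i) := by simp [hx1.1]
      rw [e5] at this
      exact absurd this (Finset.notMem_empty _)
    · ext j
      simp only [Finset.mem_filter, Finset.mem_univ, true_and]
      constructor
      · rintro (h | h)
        · have : j ∈ ini N (k - 1) := mem_ini.2 h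
          rw [← e3] at this
          exact (Finset.mem_inter.1 this).2
        · rw [Fin.ext h]; exact hx1.1
      · intro h
        by_cases hj : (j : ℕ) < k - 1
        · exact Or.inl hj
        · right
          have : j ∈ f i1 \ ini N (k - 1) := by
            rw [Finset.mem_sdiff, mem_ini]; exact ⟨h, hj⟩
          rw [hx, Finset.mem_singleton] at this
          rw [this]
  · intro f hf g hg hfg
    rw [Finset.mem_coe] at hf hg
    have hfg : f i1 = g i1 := hfg
    unfold cjb at h2
    have hm : i1 ∈ Finset.univ.filter (fun i => k - 1 < b i) := by simp; omega
    have hc1 : ((Finset.univ.filter (fun i => k - 1 < b i)).erase i1).card = 1 := by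
      rw [Finset.card_erase_of_mem hm, h2]
    obtain ⟨i2, hi2⟩ := Finset.card_eq_one.1 hc1
    have hoff : ∀ i, i ≠ i2 → f i = g i := by
      intro i hi
      by_cases h : i = i1
      · rw [h, hfg]
      · have hb : b i < k := by
          by_contra hlt
          have : i ∈ (Finset.univ.filter (fun i => k - 1 < b i)).erase i1 := by
            simp [h]; omega
          rw [hi2, Finset.mem_singleton] at this
          exact hi this
        rw [fam_forced hf i (by omega) (he _ hb), fam_forced hg i (by omega) (he _ hb)]
    funext i
    by_cases hi : i = i2
    · subst hi
      ext j
      have hs : (Finset.univ.filter (fun i => j ∈ f i)).card =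
          (Finset.univ.filter (fun i => j ∈ g i)).card := by
        rw [(mem_fam.1 hf).2 j, (mem_fam.1 hg).2 j]
      rw [Finset.card_filter, Finset.card_filter,
        ← Finset.add_sum_erase _ _ (Finset.mem_univ i),
        ← Finset.add_sum_erase _ (fun i => if j ∈ g i then 1 else 0)
          (Finset.mem_univ i)] at hs
      have he : ∑ x ∈ Finset.univ.erase i, (if j ∈ f x then 1 else 0) =
          ∑ x ∈ Finset.univ.erase i, (if j ∈ g x then 1 else 0) := by
        refine Finset.sum_congr rfl (fun x hx => ?_)
        rw [hoff x (Finset.ne_of_mem_erase hx)]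
      rw [he] at hs
      have hs' := Nat.add_right_cancel hs
      by_cases h1 : j ∈ f i <;> by_cases h2 : j ∈ g i <;> simp_all
    · exact hoff i hi

end Coef

section Parts

/-- The parts of a partition as a family. -/
def bp {n : ℕ} (q : Nat.Partition n) : q.parts.ToType → ℕ := fun x => x.1

lemma eProd_bp (N : ℕ) (R : Type) [CommRing R] {n : ℕ} (q : Nat.Partition n) :
    eProd N R q = ∏ i, esymm (Fin N) R (bp q i) := by
  unfold eProd bp
  conv_lhs => rw [← Multiset.map_univ_coe q.parts]
  rw [Multiset.map_map]
  rfl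

lemma bp_le {n : ℕ} (q : Nat.Partition n) (i : q.parts.ToType) : bp q i ≤ n :=
  part_le q (Multiset.coe_mem)

lemma cjb_bp {n : ℕ} (q : Nat.Partition n) (j : ℕ) :
    cjb (bp q) j = Multiset.countP (fun a => j < a) q.parts := by
  unfold cjb bp
  conv_rhs => rw [← Multiset.map_univ_coe q.parts]
  rw [Multiset.countP_map]
  rfl

lemma sum_bp {n : ℕ} (q : Nat.Partition n) (g : ℕ → ℕ) :
    ∑ i, g (bp q i) = (q.parts.map g).sum := by
  unfold bp
  conv_rhs => rw [← Multiset.map_univ_coe q.parts]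
  rw [Multiset.map_map]
  rfl

lemma csb_bp_n {n : ℕ} (q : Nat.Partition n) : csb (bp q) n = n := by
  unfold csb
  have : ∀ i, min (bp q i) n = id (bp q i) := fun i => min_eq_left (bp_le q i)
  simp only [this]
  rw [sum_bp, Multiset.map_id, q.parts_sum]

lemma cjb_anti {n : ℕ} (q : Nat.Partition n) {i j : ℕ} (h : i ≤ j) :
    cjb (bp q) j ≤ cjb (bp q) i := by
  unfold cjb
  apply Finset.card_le_card
  intro x
  simp only [Finset.mem_filter, Finset.mem_univ, true_and]
  omega

lemma cjb_ge {n : ℕ} (q : Nat.Partition n) {j : ℕ} (h : n ≤ j) : cjb (bp q) j = 0 := by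
  unfold cjb
  rw [Finset.card_eq_zero, Finset.filter_eq_empty_iff]
  intro x _
  have := bp_le q x
  omega

lemma cjb_inj {n : ℕ} (q q' : Nat.Partition n) (h : ∀ j, cjb (bp q) j = cjb (bp q') j) :
    q = q' := by
  apply Nat.Partition.ext
  ext a
  rcases Nat.eq_zero_or_pos a with ha | ha
  · have hz : ∀ q : Nat.Partition n, q.parts.count a = 0 := by
      intro q
      rw [Multiset.count_eq_zero]
      intro hm
      have h2 := q.parts_pos hm
      omega
    rw [hz, hz]
  · have key : ∀ s : Multiset ℕ, Multiset.count a s + Multiset.countP (fun x => a < x) s =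
        Multiset.countP (fun x => a - 1 < x) s := by
      intro s
      induction s using Multiset.induction_on with
      | empty => simp
      | cons x s ih =>
        rw [Multiset.count_cons, Multiset.countP_cons, Multiset.countP_cons]
        split_ifs <;> omega
    have h1 := key q.parts
    have h2 := key q'.parts
    have h3 := h a
    have h4 := h (a - 1)
    simp only [cjb_bp] at h3 h4
    omega

lemma csb_inj {n : ℕ} (q q' : Nat.Partition n)
    (h : ∀ k ≤ n, csb (bp q) k = csb (bp q') k) : q = q' := by
  apply cjb_inj
  intro j
  by_cases hj : n ≤ j
  · rw [cjb_ge q hj, cjb_ge q' hj]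
  · have h1 := h j (by omega)
    have h2 := h (j + 1) (by omega)
    rw [csb_range, csb_range, Finset.sum_range_succ, Finset.sum_range_succ, ← csb_range,
      ← csb_range] at h2
    omega

end Parts

end SS

namespace SS

section GraphQ

variable {n N : ℕ}

lemma adj_succ (G : SimpleGraph (Fin n)) (hG : IsNUIG G) (hconn : G.Connected)
    (i j : Fin n) (hij : (j : ℕ) = i + 1) : G.Adj i j := by
  obtain ⟨w⟩ := hconn.preconnected i j
  obtain ⟨d, _, h1, h2⟩ := w.exists_boundary_dart {x | x ≤ i} (by simp) (by
    simp only [Set.mem_setOf_eq, not_le]; exact Fin.lt_def.2 (by omega))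
  simp only [Set.mem_setOf_eq, not_le] at h1 h2
  have hadj := d.adj
  generalize d.fst = u at *
  generalize d.snd = v at *
  have a1 : G.Adj u j := by
    by_cases h : v = j
    · rwa [← h]
    · have h3 : (v : ℕ) ≠ j := fun h' => h (Fin.ext h')
      exact (hG u j v (Fin.lt_def.2 (by rw [Fin.le_def] at h1; omega))
        (Fin.lt_def.2 (by rw [Fin.lt_def] at h2; omega)) hadj).1
  by_cases h : u = i
  · rwa [← h]
  · have h3 : (u : ℕ) ≠ i := fun h' => h (Fin.ext h')
    exact (hG u i j (Fin.lt_def.2 (by rw [Fin.le_def] at h1; omega))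
      (Fin.lt_def.2 (by omega)) a1).2

lemma adj_succ2 (G : SimpleGraph (Fin n)) (hG : IsNUIG G)
    (hcut : ∀ v, ¬ IsCutVertex G v)
    (i j : Fin n) (hij : (j : ℕ) = i + 2) : G.Adj i j := by
  have hv : (i : ℕ) + 1 < n := by have := j.2; omega
  have hc := hcut ⟨i + 1, hv⟩
  unfold IsCutVertex at hc
  rw [not_not] at hc
  obtain ⟨w⟩ := hc ⟨i, by simp [Fin.ext_iff]⟩ ⟨j, by simp [Fin.ext_iff]; omega⟩
  obtain ⟨d, _, h1, h2⟩ := w.exists_boundary_dart {x | x.1 ≤ i} (by simp) (by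
    simp only [Set.mem_setOf_eq, not_le]; exact Fin.lt_def.2 (by omega))
  simp only [Set.mem_setOf_eq, not_le] at h1 h2
  have hadj : G.Adj d.fst.1 d.snd.1 := d.adj
  have hne : d.snd.1 ≠ ⟨i + 1, hv⟩ := d.snd.2
  generalize d.fst.1 = u at *
  generalize d.snd.1 = v at *
  have hne' : (v : ℕ) ≠ i + 1 := fun h => hne (Fin.ext h)
  have a1 : G.Adj u j := by
    by_cases h : v = j
    · rwa [← h]
    · have h3 : (v : ℕ) ≠ j := fun h' => h (Fin.ext h')
      exact (hG u j v (Fin.lt_def.2 (by rw [Fin.le_def] at h1; omega))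
        (Fin.lt_def.2 (by rw [Fin.lt_def] at h2; omega)) hadj).1
  by_cases h : u = i
  · rwa [← h]
  · have h3 : (u : ℕ) ≠ i := fun h' => h (Fin.ext h')
    exact (hG u i j (Fin.lt_def.2 (by rw [Fin.le_def] at h1; omega))
      (Fin.lt_def.2 (by omega)) a1).2

/-- Vertices at distance at most two are adjacent. -/
def Sq (G : SimpleGraph (Fin n)) : Prop :=
  ∀ i j : Fin n, i < j → (j : ℕ) ≤ i + 2 → G.Adj i j

lemma sq_of (G : SimpleGraph (Fin n)) (hG : IsNUIG G) (hconn : G.Connected)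
    (hcut : ∀ v, ¬ IsCutVertex G v) : Sq G := by
  intro i j h1 h2
  rw [Fin.lt_def] at h1
  by_cases h : (j : ℕ) = i + 1
  · exact adj_succ G hG hconn i j h
  · exact adj_succ2 G hG hcut i j (by omega)

lemma sq_ne {G : SimpleGraph (Fin n)} (hs : Sq G) {κ : Fin n → Fin N} (hκ : IsProper G κ)
    (i j : Fin n) (h1 : (i : ℕ) < j) (h2 : (j : ℕ) ≤ i + 2) : (κ i : ℕ) ≠ κ j :=
  fun h => hκ i j (hs i j h1 h2) (Fin.ext h)

lemma bound_one {G : SimpleGraph (Fin n)} (hs : Sq G) {κ : Fin n → Fin N} (hκ : IsProper G κ) :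
    (Finset.univ.filter (fun i => (κ i : ℕ) < 1)).card ≤ (n + 2) / 3 := by
  rw [← Finset.card_range ((n + 2) / 3)]
  apply Finset.card_le_card_of_injOn (fun i : Fin n => (i : ℕ) / 3)
  · intro i _
    have := i.2
    simp only [Finset.coe_range, Set.mem_Iio]
    omega
  · intro i hi j hj hij
    simp only [Finset.coe_filter, Finset.mem_univ, true_and, Set.mem_setOf_eq] at hi hj hij
    apply Fin.ext
    by_contra hne
    rcases Nat.lt_or_gt_of_ne hne with h | h
    · exact sq_ne hs hκ i j h (by omega) (by omega)
    · exact sq_ne hs hκ j i h (by omega) (by omega)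

lemma bound_two {G : SimpleGraph (Fin n)} (hs : Sq G) {κ : Fin n → Fin N} (hκ : IsProper G κ) :
    (Finset.univ.filter (fun i => (κ i : ℕ) < 2)).card ≤ n - n / 3 := by
  have h1 := Finset.card_filter_add_card_filter_not (s := (Finset.univ : Finset (Fin n)))
    (fun i => (κ i : ℕ) < 2)
  rw [Finset.card_univ, Fintype.card_fin] at h1
  have h2 : n / 3 ≤ (Finset.univ.filter (fun i => ¬ (κ i : ℕ) < 2)).card := by
    have h3 : Finset.range (n / 3) ⊆
        (Finset.univ.filter (fun i => ¬ (κ i : ℕ) < 2)).image (fun i : Fin n => (i : ℕ) / 3) := by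
      intro b hb
      rw [Finset.mem_range] at hb
      rw [Finset.mem_image]
      have l0 : 3 * b < n := by omega
      have l1 : 3 * b + 1 < n := by omega
      have l2 : 3 * b + 2 < n := by omega
      have e1 := sq_ne hs hκ ⟨3 * b, l0⟩ ⟨3 * b + 1, l1⟩ (by simp) (by simp)
      have e2 := sq_ne hs hκ ⟨3 * b, l0⟩ ⟨3 * b + 2, l2⟩ (by simp) (by simp)
      have e3 := sq_ne hs hκ ⟨3 * b + 1, l1⟩ ⟨3 * b + 2, l2⟩ (by simp) (by simp)
      by_cases c0 : (κ ⟨3 * b, l0⟩ : ℕ) < 2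
      · by_cases c1 : (κ ⟨3 * b + 1, l1⟩ : ℕ) < 2
        · refine ⟨⟨3 * b + 2, l2⟩, ?_, by simp only; omega⟩
          simp only [Finset.mem_filter, Finset.mem_univ, true_and]; omega
        · refine ⟨⟨3 * b + 1, l1⟩, ?_, by simp only; omega⟩
          simp only [Finset.mem_filter, Finset.mem_univ, true_and]; omega
      · refine ⟨⟨3 * b, l0⟩, ?_, by simp only; omega⟩
        simp only [Finset.mem_filter, Finset.mem_univ, true_and]; omega
    have h4 := Finset.card_le_card h3
    rw [Finset.card_range] at h4
    exact h4.trans Finset.card_image_le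
  omega

/-- Proper colourings with given content and number of ascents. -/
noncomputable def cols (N : ℕ) (G : SimpleGraph (Fin n)) (ν : Fin N → ℕ) (m : ℕ) :
    Finset (Fin n → Fin N) :=
  Finset.univ.filter (fun κ => IsProper G κ ∧
    (∀ j, (Finset.univ.filter (fun i => κ i = j)).card = ν j) ∧ ascNum G κ = m)

lemma mem_cols {G : SimpleGraph (Fin n)} {ν : Fin N → ℕ} {m : ℕ} {κ : Fin n → Fin N} :
    κ ∈ cols N G ν m ↔ IsProper G κ ∧
    (∀ j, (Finset.univ.filter (fun i => κ i = j)).card = ν j) ∧ ascNum G κ = m := by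
  simp [cols]

lemma coeff_chromQ (G : SimpleGraph (Fin n)) (ν : Fin N → ℕ) (m : ℕ) :
    (coeff (Finsupp.equivFunOnFinite.symm ν) (chromQSym n N G)).coeff m =
      ((cols N G ν m).card : ℤ) := by
  unfold chromQSym cols
  rw [coeff_sum, Polynomial.finsetSum_coeff, ← Finset.sum_boole]
  refine Finset.sum_congr rfl (fun κ _ => ?_)
  have hmon : (∏ i, X (κ i) : MvPolynomial (Fin N) (Polynomial ℤ)) =
      monomial (∑ i, Finsupp.single (κ i) 1) 1 := by
    rw [monomial_sum_one]; rfl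
  have hiff : (∑ i, Finsupp.single (κ i) 1 = Finsupp.equivFunOnFinite.symm ν) ↔
      ∀ j, (Finset.univ.filter (fun i => κ i = j)).card = ν j := by
    rw [DFunLike.ext_iff]
    apply forall_congr'
    intro j
    rw [Finsupp.finsetSum_apply, Finset.card_filter]
    simp only [Finsupp.single_apply]
    rfl
  by_cases hp : IsProper G κ
  · rw [if_pos hp, hmon, coeff_C_mul, coeff_monomial]
    by_cases hc : ∀ j, (Finset.univ.filter (fun i => κ i = j)).card = ν j
    · rw [if_pos (hiff.2 hc), mul_one, Polynomial.coeff_X_pow]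
      by_cases hm : ascNum G κ = m
      · rw [if_pos hm.symm, if_pos ⟨hp, hc, hm⟩]
      · rw [if_neg (fun h => hm h.symm), if_neg (fun h => hm h.2.2)]
    · rw [if_neg (fun h => hc (hiff.1 h)), if_neg (fun h => hc h.2.1)]
      simp
  · rw [if_neg hp, if_neg (fun h => hp h.1)]
    simp

lemma cols_count {G : SimpleGraph (Fin n)} {ν : Fin N → ℕ} {m : ℕ} {κ : Fin n → Fin N}
    (h : κ ∈ cols N G ν m) (k : ℕ) :
    (Finset.univ.filter (fun i => (κ i : ℕ) < k)).card = ∑ j ∈ ini N k, ν j := by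
  rw [mem_cols] at h
  rw [Finset.card_eq_sum_card_fiberwise (f := κ) (t := ini N k)]
  · refine Finset.sum_congr rfl (fun j hj => ?_)
    rw [← h.2.1 j, Finset.filter_filter]
    congr 1
    apply Finset.filter_congr
    intro i _
    rw [mem_ini] at hj
    constructor
    · exact fun h => h.2
    · intro h; exact ⟨by rw [h]; exact hj, h⟩
  · intro i hi
    simp only [Finset.coe_filter, Finset.mem_univ, true_and, Set.mem_setOf_eq] at hi
    exact mem_ini.2 hi

end GraphQ

section Vanish

variable {n N : ℕ}

/-- Column data of a partition as a content vector. -/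
noncomputable def nu (N : ℕ) {n : ℕ} (q : Nat.Partition n) : Fin N → ℕ := fun j => cjb (bp q) j

/-- The coefficient of `x^{p'}` in `e_q`. -/
noncomputable def Mq (N : ℕ) {n : ℕ} (q p : Nat.Partition n) : ℕ := (fam N (bp q) (nu N p)).card

lemma Mq_dom (hN : n ≤ N) {q p : Nat.Partition n} (h : Mq N q p ≠ 0) (k : ℕ) (hk : k ≤ n) :
    csb (bp p) k ≤ csb (bp q) k := by
  unfold Mq at h
  obtain ⟨f, hf⟩ := Finset.card_ne_zero.1 h
  exact fam_dom hf (hk.trans hN)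

lemma Mq_self (hN : n ≤ N) (p : Nat.Partition n) : Mq N p p = 1 :=
  fam_self (bp p) (fun i => (bp_le p i).trans hN)

lemma master (G : SimpleGraph (Fin n)) (c : Nat.Partition n → Polynomial ℤ)
    (h : chromQSym n N G = ∑ q : Nat.Partition n, C (c q) * eProd N (Polynomial ℤ) q)
    (p : Nat.Partition n) (m : ℕ) :
    ∑ q, (c q).coeff m * (Mq N q p : ℤ) = ((cols N G (nu N p) m).card : ℤ) := by
  rw [← coeff_chromQ, h, coeff_sum, Polynomial.finsetSum_coeff]
  refine Finset.sum_congr rfl (fun q _ => ?_)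
  rw [coeff_C_mul, eProd_bp, coeff_prod_esymm, Polynomial.coeff_mul_natCast]
  rfl

lemma vanish (hN : n ≤ N) (G : SimpleGraph (Fin n)) (c : Nat.Partition n → Polynomial ℤ)
    (h : chromQSym n N G = ∑ q : Nat.Partition n, C (c q) * eProd N (Polynomial ℤ) q)
    (k B : ℕ) (hk : k ≤ n)
    (hB : ∀ κ : Fin n → Fin N, IsProper G κ →
      (Finset.univ.filter (fun i => (κ i : ℕ) < k)).card ≤ B)
    (q : Nat.Partition n) (m : ℕ) (hq : (c q).coeff m ≠ 0) : csb (bp q) k ≤ B := by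
  by_contra hlt
  push Not at hlt
  obtain ⟨p, hp, hmax⟩ := Finset.exists_max_image
    (Finset.univ.filter (fun q : Nat.Partition n => (c q).coeff m ≠ 0 ∧ B < csb (bp q) k))
    (fun q => ∑ j ∈ Finset.range (n + 1), csb (bp q) j) ⟨q, by simp [hq, hlt]⟩
  simp only [Finset.mem_filter, Finset.mem_univ, true_and] at hp hmax
  have h1 := master G c h p m
  have h2 : cols N G (nu N p) m = ∅ := by
    rw [Finset.eq_empty_iff_forall_notMem]
    intro κ hκ
    have h3 := cols_count hκ k
    have h4 : ∑ j ∈ ini N k, nu N p j = csb (bp p) k := csb_ini (bp p) k (hk.trans hN)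
    have h5 := hB κ (mem_cols.1 hκ).1
    omega
  rw [h2, Finset.card_empty, Finset.sum_eq_single p] at h1
  · rw [Mq_self hN] at h1
    exact hp.1 (by simpa using h1)
  · intro q' _ hne
    by_contra hmul
    have hc : (c q').coeff m ≠ 0 := fun h => hmul (by rw [h, zero_mul])
    have hM : Mq N q' p ≠ 0 := fun h => hmul (by rw [h]; simp)
    have hdom := Mq_dom hN hM
    have hle := hmax q' ⟨hc, hp.2.trans_le (hdom k hk)⟩
    have hle2 : ∑ j ∈ Finset.range (n + 1), csb (bp p) j ≤
        ∑ j ∈ Finset.range (n + 1), csb (bp q') j :=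
      Finset.sum_le_sum (fun j hj => hdom j (by rw [Finset.mem_range] at hj; omega))
    have heq := (Finset.sum_eq_sum_iff_of_le (s := Finset.range (n + 1))
      (f := fun j => csb (bp p) j) (g := fun j => csb (bp q') j)
      (fun j hj => hdom j (by rw [Finset.mem_range] at hj; omega))).1 (le_antisymm hle2 hle)
    exact hne (csb_inj q' p (fun j hj => (heq j (Finset.mem_range.2 (by omega))).symm))
  · intro h; exact absurd (Finset.mem_univ _) h

end Vanish

end SS

namespace SS

section Split

variable {n N : ℕ}

lemma cols_lt {G : SimpleGraph (Fin n)} {ν : Fin N → ℕ} {m : ℕ} {κ : Fin n → Fin N}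
    (h : κ ∈ cols N G ν m) (hz : ∀ j : Fin N, 3 ≤ (j : ℕ) → ν j = 0) (i : Fin n) :
    (κ i : ℕ) < 3 := by
  by_contra hlt
  have h1 := (mem_cols.1 h).2.1 (κ i)
  rw [hz _ (by omega), Finset.card_eq_zero] at h1
  have : i ∈ Finset.univ.filter (fun i' => κ i' = κ i) := by simp
  rw [h1] at this
  exact absurd this (Finset.notMem_empty _)

lemma split_ineq (hN : 4 ≤ N) (G : SimpleGraph (Fin n)) (νB νA : Fin N → ℕ) (m : ℕ)
    (hB2 : νB ⟨2, by omega⟩ = 2) (hB : ∀ j : Fin N, 3 ≤ (j : ℕ) → νB j = 0)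
    (hA2 : νA ⟨2, by omega⟩ = 1) (hA3 : νA ⟨3, by omega⟩ = 1)
    (hAB : ∀ j : Fin N, (j : ℕ) ≠ 2 → (j : ℕ) ≠ 3 → νA j = νB j) :
    2 * (cols N G νB m).card ≤ (cols N G νA m).card := by
  set c2 : Fin N := ⟨2, by omega⟩ with hc2
  set c3 : Fin N := ⟨3, by omega⟩ with hc3
  have hcard : ((cols N G νB m).sigma
      (fun κ => Finset.univ.filter (fun i => κ i = c2))).card = 2 * (cols N G νB m).card := by
    rw [Finset.card_sigma, Finset.sum_const_nat (m := 2), mul_comm]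
    intro κ hκ
    rw [(mem_cols.1 hκ).2.1 c2, hB2]
  rw [← hcard]
  apply Finset.card_le_card_of_injOn (fun x => Function.update x.1 x.2 c3)
  · rintro ⟨κ, u⟩ hx
    simp only [Finset.coe_sigma, Set.mem_sigma_iff, Finset.mem_coe, Finset.mem_filter,
      Finset.mem_univ, true_and] at hx
    obtain ⟨hκ, hu⟩ := hx
    have hlt := cols_lt hκ hB
    obtain ⟨hp, hcont, hasc⟩ := mem_cols.1 hκ
    have hu2 : (κ u : ℕ) = 2 := by rw [hu]
    have hne3 : ∀ i, κ i ≠ c3 := fun i h => by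
      have := hlt i; rw [h] at this; simp [hc3] at this
    rw [Finset.mem_coe, mem_cols]
    refine ⟨?_, ?_, ?_⟩
    · intro i j hij
      have hij' := hij.ne
      simp only [Function.update_apply]
      split_ifs with h1 h2 h2
      · exact absurd (h1.trans h2.symm) hij'
      · exact fun h => hne3 j h.symm
      · exact hne3 i
      · exact hp i j hij
    · intro j
      by_cases hj3 : j = c3
      · rw [hj3, hA3, Finset.card_eq_one]
        refine ⟨u, ?_⟩
        ext i
        simp only [Function.update_apply, Finset.mem_filter, Finset.mem_univ, true_and,
          Finset.mem_singleton]
        split_ifs with h1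
        · simp [h1]
        · simp [h1, hne3 i]
      · by_cases hj2 : j = c2
        · rw [hj2, hA2]
          have : Finset.univ.filter (fun i => Function.update κ u c3 i = c2) =
              (Finset.univ.filter (fun i => κ i = c2)).erase u := by
            ext i
            simp only [Function.update_apply, Finset.mem_filter, Finset.mem_univ, true_and,
              Finset.mem_erase]
            split_ifs with h1
            · simp [h1, hc2, hc3]
            · simp [h1]
          rw [this, Finset.card_erase_of_mem (by simp [hu]), hcont c2, hB2]
        · rw [hAB j (fun h => hj2 (Fin.ext h)) (fun h => hj3 (Fin.ext h)), ← hcont j]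
          congr 1
          apply Finset.filter_congr
          intro i _
          simp only [Function.update_apply]
          split_ifs with h1
          · rw [h1, hu]
            exact ⟨fun h => absurd h.symm hj3, fun h => absurd h.symm hj2⟩
          · rfl
    · rw [← hasc]
      unfold ascNum
      congr 1
      apply Finset.filter_congr
      rintro ⟨i, j⟩ _
      simp only
      apply and_congr_right
      intro hij
      apply and_congr_right
      intro hlt'
      have hi := hlt i
      have hj := hlt j
      have hne : (κ i : ℕ) ≠ κ j := fun h => hp i j hij (Fin.ext h)
      simp only [Function.update_apply]
      have h33 : (c3 : ℕ) = 3 := rfl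
      split_ifs with h1 h2 h2
      · exact absurd (h1.trans h2.symm) hij.ne
      · rw [Fin.lt_def, Fin.lt_def]; rw [h1]; omega
      · rw [Fin.lt_def, Fin.lt_def]; rw [h2] at hne ⊢; omega
      · rfl
  · rintro ⟨κ, u⟩ hx ⟨κ', u'⟩ hx' heq
    simp only [Finset.coe_sigma, Set.mem_sigma_iff, Finset.mem_coe, Finset.mem_filter,
      Finset.mem_univ, true_and] at hx hx' heq
    have hne3 : ∀ κ ∈ cols N G νB m, ∀ i, κ i ≠ c3 := fun κ hκ i h => by
      have := cols_lt hκ hB i; rw [h] at this; simp [hc3] at this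
    have huu : u = u' := by
      by_contra hne
      have := congrFun heq u
      rw [Function.update_self, Function.update_of_ne hne] at this
      exact hne3 κ' hx'.1 u this.symm
    subst huu
    have hk : κ = κ' := by
      funext i
      by_cases hi : i = u
      · rw [hi, hx.2, hx'.2]
      · have := congrFun heq i
        rwa [Function.update_of_ne hi, Function.update_of_ne hi] at this
    subst hk
    rfl

end Split

section Words

variable {n N : ℕ}

/-- Number of ascents of a word over the graph joining vertices at distance at most two. -/
def ascW (w : Fin n → Fin 4) : ℕ :=
  ((Finset.univ : Finset (Fin n × Fin n)).filter fun p =>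
    p.1 < p.2 ∧ (p.2 : ℕ) ≤ p.1 + 2 ∧ w p.1 < w p.2).card

lemma asc_word (G : SimpleGraph (Fin n))
    (hadj : ∀ i j : Fin n, i < j → (G.Adj i j ↔ (j : ℕ) ≤ i + 2))
    (w : Fin n → Fin 4) (κ : Fin n → Fin N) (h : ∀ i, (κ i : ℕ) = w i) :
    ascNum G κ = ascW w := by
  unfold ascNum ascW
  congr 1
  apply Finset.filter_congr
  rintro ⟨i, j⟩ _
  simp only [Fin.lt_def, h]
  constructor
  · rintro ⟨h1, h2, h3⟩; exact ⟨h2, (hadj i j h2).1 h1, h3⟩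
  · rintro ⟨h1, h2, h3⟩; exact ⟨(hadj i j h1).2 h2, h1, h3⟩

lemma list_bound (hN : 4 ≤ N) (G : SimpleGraph (Fin n))
    (hadj : ∀ i j : Fin n, i < j → (G.Adj i j ↔ (j : ℕ) ≤ i + 2))
    (ν : Fin N → ℕ) (a : Fin 4 → ℕ) (hν : ∀ (j : Fin N) (h : (j : ℕ) < 4), ν j = a ⟨j, h⟩)
    (hz : ∀ j : Fin N, 4 ≤ (j : ℕ) → ν j = 0) (m : ℕ) (L : Finset (Fin n → Fin 4))
    (h1 : ∀ w ∈ L, ∀ i j : Fin n, i < j → (j : ℕ) ≤ i + 2 → w i ≠ w j)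
    (h2 : ∀ w ∈ L, ∀ j, (Finset.univ.filter (fun i => w i = j)).card = a j)
    (h3 : ∀ w ∈ L, ascW w = m) : L.card ≤ (cols N G ν m).card := by
  apply Finset.card_le_card_of_injOn (fun w i => Fin.castLE hN (w i))
  · intro w hw
    rw [Finset.mem_coe] at hw
    rw [Finset.mem_coe, mem_cols]
    refine ⟨?_, ?_, ?_⟩
    · intro i j hij he
      have he' : w i = w j := Fin.castLE_injective hN he
      rcases lt_or_gt_of_ne hij.ne with h | h
      · exact h1 w hw i j h ((hadj i j h).1 hij) he'
      · exact h1 w hw j i h ((hadj j i h).1 hij.symm) he'.symm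
    · intro j
      by_cases hj : (j : ℕ) < 4
      · rw [hν j hj, ← h2 w hw]
        congr 1
        apply Finset.filter_congr
        intro i _
        rw [Fin.ext_iff, Fin.ext_iff]
        rfl
      · rw [hz j (by omega), Finset.card_eq_zero, Finset.filter_eq_empty_iff]
        intro i _ h
        have := (w i).2
        rw [Fin.ext_iff] at h
        simp only [Fin.val_castLE] at h
        omega
    · exact (asc_word G hadj w (fun i => Fin.castLE hN (w i)) (fun i => rfl)).trans (h3 w hw)
  · intro w _ w' _ h
    funext i
    exact Fin.castLE_injective hN (congrFun h i)

lemma two_words (G : SimpleGraph (Fin n))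
    (hadj : ∀ i j : Fin n, i < j → (G.Adj i j ↔ (j : ℕ) ≤ i + 2))
    (νB νA : Fin N → ℕ) (t1 t2 : Fin n → Fin 4) (m K : ℕ)
    (hw : ∀ κ ∈ cols N G νB m, (∀ i, (κ i : ℕ) = t1 i) ∨ (∀ i, (κ i : ℕ) = t2 i))
    (hne : ascW t1 ≠ ascW t2) (h1 : K ≤ (cols N G νA (ascW t1)).card)
    (h2 : K ≤ (cols N G νA (ascW t2)).card) :
    K * (cols N G νB m).card ≤ (cols N G νA m).card := by
  rcases Finset.eq_empty_or_nonempty (cols N G νB m) with he | ⟨κ, hκ⟩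
  · rw [he]; simp
  · have hone : (cols N G νB m).card ≤ 1 := by
      rw [Finset.card_le_one]
      intro κ hκ κ' hκ'
      have a1 := (mem_cols.1 hκ).2.2
      have a2 := (mem_cols.1 hκ').2.2
      rcases hw κ hκ with h | h <;> rcases hw κ' hκ' with h' | h'
      · funext i; exact Fin.ext (by rw [h, h'])
      · rw [asc_word G hadj _ κ h] at a1; rw [asc_word G hadj _ κ' h'] at a2
        exact absurd (a1.trans a2.symm) hne
      · rw [asc_word G hadj _ κ h] at a1; rw [asc_word G hadj _ κ' h'] at a2
        exact absurd (a2.trans a1.symm) hne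
      · funext i; exact Fin.ext (by rw [h, h'])
    have hK : K ≤ (cols N G νA m).card := by
      have a1 := (mem_cols.1 hκ).2.2
      rcases hw κ hκ with h | h
      · rw [asc_word G hadj _ κ h] at a1; rw [← a1]; exact h1
      · rw [asc_word G hadj _ κ h] at a1; rw [← a1]; exact h2
    calc K * (cols N G νB m).card ≤ K * 1 := Nat.mul_le_mul_left _ hone
      _ ≤ _ := by omega

set_option maxRecDepth 100000 in
lemma four_ineq (hN : 4 ≤ N) (G : SimpleGraph (Fin 4)) (hs : Sq G) (νB νA : Fin N → ℕ) (m : ℕ)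
    (hB0 : νB ⟨0, by omega⟩ = 2)
    (hB : ∀ j : Fin N, 3 ≤ (j : ℕ) → νB j = 0)
    (hA : ∀ (j : Fin N), (j : ℕ) < 4 → νA j = 1)
    (hAz : ∀ j : Fin N, 4 ≤ (j : ℕ) → νA j = 0) :
    4 * (cols N G νB m).card ≤ (cols N G νA m).card := by
  rcases Finset.eq_empty_or_nonempty (cols N G νB m) with he | ⟨κ₀, hκ₀⟩
  · rw [he]; simp
  have hdet : ∀ κ ∈ cols N G νB m, ((κ 0 : ℕ) = 0 ∧ (κ 1 : ℕ) = 1 ∧ (κ 2 : ℕ) = 2 ∧ (κ 3 : ℕ) = 0)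
      ∨ ((κ 0 : ℕ) = 0 ∧ (κ 1 : ℕ) = 2 ∧ (κ 2 : ℕ) = 1 ∧ (κ 3 : ℕ) = 0) := by
    intro κ hκ
    obtain ⟨hp, hcont, -⟩ := mem_cols.1 hκ
    have e01 := sq_ne hs hp 0 1 (by decide) (by decide)
    have e02 := sq_ne hs hp 0 2 (by decide) (by decide)
    have e12 := sq_ne hs hp 1 2 (by decide) (by decide)
    have e13 := sq_ne hs hp 1 3 (by decide) (by decide)
    have e23 := sq_ne hs hp 2 3 (by decide) (by decide)
    have l0 := cols_lt hκ hB 0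
    have l1 := cols_lt hκ hB 1
    have l2 := cols_lt hκ hB 2
    have l3 := cols_lt hκ hB 3
    have hc := hcont ⟨0, by omega⟩
    rw [hB0, Finset.card_filter, Fin.sum_univ_four] at hc
    simp only [Fin.ext_iff] at hc
    split_ifs at hc <;> omega
  have hadj : ∀ i j : Fin 4, i < j → (G.Adj i j ↔ (j : ℕ) ≤ i + 2) := by
    intro i j hij
    refine ⟨fun h => ?_, fun h => hs i j hij h⟩
    by_contra hlt
    have hi : i = 0 := by apply Fin.ext; have := j.2; simp; omega
    have hj : j = 3 := by apply Fin.ext; have := j.2; simp; omega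
    subst hi hj
    apply (mem_cols.1 hκ₀).1 _ _ h
    apply Fin.ext
    rcases hdet κ₀ hκ₀ with h | h <;> omega
  refine two_words G hadj νB νA ![0, 1, 2, 0] ![0, 2, 1, 0] m 4 ?_ (by decide) ?_ ?_
  · intro κ hκ
    rcases hdet κ hκ with ⟨h0, h1, h2, h3⟩ | ⟨h0, h1, h2, h3⟩
    · left; intro i; fin_cases i <;> simp [h0, h1, h2, h3]
    · right; intro i; fin_cases i <;> simp [h0, h1, h2, h3]
  · exact list_bound hN G hadj νA (fun _ => 1) (fun j h => hA j h) hAz _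
      {![0, 2, 3, 1], ![0, 3, 1, 2], ![1, 0, 3, 2], ![1, 2, 0, 3]} (by decide) (by decide)
      (by decide)
  · exact list_bound hN G hadj νA (fun _ => 1) (fun j h => hA j h) hAz _
      {![0, 3, 2, 1], ![1, 3, 0, 2], ![1, 3, 2, 0], ![2, 1, 0, 3]} (by decide) (by decide)
      (by decide)

set_option maxRecDepth 100000 in
lemma five_ineq (hN : 4 ≤ N) (G : SimpleGraph (Fin 5)) (hG : IsNUIG G) (hs : Sq G)
    (νB νA : Fin N → ℕ) (m : ℕ)
    (hB0 : νB ⟨0, by omega⟩ = 2) (hB1 : νB ⟨1, by omega⟩ = 2)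
    (hB : ∀ j : Fin N, 3 ≤ (j : ℕ) → νB j = 0)
    (hA0 : νA ⟨0, by omega⟩ = 2)
    (hA : ∀ (j : Fin N), (j : ℕ) < 4 → (j : ℕ) ≠ 0 → νA j = 1)
    (hAz : ∀ j : Fin N, 4 ≤ (j : ℕ) → νA j = 0) :
    3 * (cols N G νB m).card ≤ (cols N G νA m).card := by
  rcases Finset.eq_empty_or_nonempty (cols N G νB m) with he | ⟨κ₀, hκ₀⟩
  · rw [he]; simp
  have hdet : ∀ κ ∈ cols N G νB m,
      ((κ 0 : ℕ) = 0 ∧ (κ 1 : ℕ) = 1 ∧ (κ 2 : ℕ) = 2 ∧ (κ 3 : ℕ) = 0 ∧ (κ 4 : ℕ) = 1)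
      ∨ ((κ 0 : ℕ) = 1 ∧ (κ 1 : ℕ) = 0 ∧ (κ 2 : ℕ) = 2 ∧ (κ 3 : ℕ) = 1 ∧ (κ 4 : ℕ) = 0) := by
    intro κ hκ
    obtain ⟨hp, hcont, -⟩ := mem_cols.1 hκ
    have e01 := sq_ne hs hp 0 1 (by decide) (by decide)
    have e02 := sq_ne hs hp 0 2 (by decide) (by decide)
    have e12 := sq_ne hs hp 1 2 (by decide) (by decide)
    have e13 := sq_ne hs hp 1 3 (by decide) (by decide)
    have e23 := sq_ne hs hp 2 3 (by decide) (by decide)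
    have e24 := sq_ne hs hp 2 4 (by decide) (by decide)
    have e34 := sq_ne hs hp 3 4 (by decide) (by decide)
    have l0 := cols_lt hκ hB 0
    have l1 := cols_lt hκ hB 1
    have l2 := cols_lt hκ hB 2
    have l3 := cols_lt hκ hB 3
    have l4 := cols_lt hκ hB 4
    have h3 : (κ 3 : ℕ) = κ 0 := by omega
    have h4 : (κ 4 : ℕ) = κ 1 := by omega
    have hc := hcont ⟨0, by omega⟩
    rw [hB0, Finset.card_filter, Fin.sum_univ_five] at hc
    simp only [Fin.ext_iff] at hc
    have hc' := hcont ⟨1, by omega⟩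
    rw [hB1, Finset.card_filter, Fin.sum_univ_five] at hc'
    simp only [Fin.ext_iff] at hc'
    rw [h3, h4] at hc hc'
    have h2 : (κ 2 : ℕ) = 2 := by
      by_contra hne
      by_cases h20 : (κ 2 : ℕ) = 0
      · rw [if_neg (by omega), if_neg (by omega), if_pos h20] at hc; omega
      · have h21 : (κ 2 : ℕ) = 1 := by omega
        rw [if_neg (by omega), if_neg (by omega), if_pos h21] at hc'; omega
    omega
  have hnot : ¬ G.Adj 0 3 ∧ ¬ G.Adj 1 4 := by
    constructor
    · intro h
      apply (mem_cols.1 hκ₀).1 _ _ h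
      apply Fin.ext
      rcases hdet κ₀ hκ₀ with h | h <;> omega
    · intro h
      apply (mem_cols.1 hκ₀).1 _ _ h
      apply Fin.ext
      rcases hdet κ₀ hκ₀ with h | h <;> omega
  have hnot2 : ¬ G.Adj 0 4 := fun h => hnot.1 (hG 0 3 4 (by decide) (by decide) h).1
  have hadj : ∀ i j : Fin 5, i < j → (G.Adj i j ↔ (j : ℕ) ≤ i + 2) := by
    intro i j hij
    refine ⟨fun h => ?_, fun h => hs i j hij h⟩
    by_contra hlt
    have : (i = 0 ∧ j = 3) ∨ (i = 1 ∧ j = 4) ∨ (i = 0 ∧ j = 4) := by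
      clear h
      revert i j
      decide
    rcases this with ⟨rfl, rfl⟩ | ⟨rfl, rfl⟩ | ⟨rfl, rfl⟩
    · exact hnot.1 h
    · exact hnot.2 h
    · exact hnot2 h
  have hν : ∀ (j : Fin N) (h : (j : ℕ) < 4), νA j = ![2, 1, 1, 1] ⟨j, h⟩ := by
    intro j h
    by_cases h0 : (j : ℕ) = 0
    · have : j = ⟨0, lt_of_lt_of_le (by decide) hN⟩ := Fin.ext h0
      subst this
      rw [hA0]; rfl
    · rw [hA j h h0]
      have : (j : ℕ) = 1 ∨ (j : ℕ) = 2 ∨ (j : ℕ) = 3 := by omega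
      rcases this with h | h | h <;> simp [h]
  refine two_words G hadj νB νA ![0, 1, 2, 0, 1] ![1, 0, 2, 1, 0] m 3 ?_ (by decide) ?_ ?_
  · intro κ hκ
    rcases hdet κ hκ with ⟨h0, h1, h2, h3, h4⟩ | ⟨h0, h1, h2, h3, h4⟩
    · left; intro i; fin_cases i <;> simp [h0, h1, h2, h3, h4]
    · right; intro i; fin_cases i <;> simp [h0, h1, h2, h3, h4]
  · exact list_bound hN G hadj νA ![2, 1, 1, 1] hν hAz _
      {![0, 1, 3, 0, 2], ![0, 1, 3, 2, 0], ![0, 2, 1, 0, 3]} (by decide) (by decide)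
      (by decide)
  · exact list_bound hN G hadj νA ![2, 1, 1, 1] hν hAz _
      {![0, 2, 3, 1, 0], ![0, 3, 1, 2, 0], ![0, 3, 2, 0, 1]} (by decide) (by decide)
      (by decide)

end Words

end SS

namespace SS

section FinalQ

variable {n N : ℕ}

/-- The sequence `c` is `(a₀,a₁,a₂,a₃,0,0,…)`. -/
def Is4 (c : ℕ → ℕ) (a₀ a₁ a₂ a₃ : ℕ) : Prop :=
  c 0 = a₀ ∧ c 1 = a₁ ∧ c 2 = a₂ ∧ c 3 = a₃ ∧ ∀ j, 4 ≤ j → c j = 0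

lemma Is4.ext {c d : ℕ → ℕ} {a₀ a₁ a₂ a₃ : ℕ} (h : Is4 c a₀ a₁ a₂ a₃) (h' : Is4 d a₀ a₁ a₂ a₃)
    (j : ℕ) : c j = d j := by
  obtain ⟨h0, h1, h2, h3, h4⟩ := h
  obtain ⟨k0, k1, k2, k3, k4⟩ := h'
  rcases j with _ | _ | _ | _ | j
  · rw [h0, k0]
  · rw [h1, k1]
  · rw [h2, k2]
  · rw [h3, k3]
  · rw [h4 _ (by omega), k4 _ (by omega)]

lemma classify_big (hn : 4 ≤ n) (c : ℕ → ℕ) (hanti : ∀ i j, i ≤ j → c j ≤ c i)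
    (hsum : ∑ j ∈ Finset.range n, c j = n) (hz : ∀ j, n ≤ j → c j = 0)
    (h1 : c 0 ≤ (n + 2) / 3) (h2 : c 0 + c 1 ≤ n - n / 3) (h3 : n ≤ c 0 + c 1 + 2) :
    (n = 4 ∧ (Is4 c 2 1 1 0 ∨ Is4 c 1 1 1 1)) ∨ (n = 5 ∧ (Is4 c 2 2 1 0 ∨ Is4 c 2 1 1 1)) ∨
    (n = 6 ∧ (Is4 c 2 2 2 0 ∨ Is4 c 2 2 1 1)) ∨ (n = 7 ∧ (Is4 c 3 2 2 0 ∨ Is4 c 3 2 1 1)) ∨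
    (n = 8 ∧ (Is4 c 3 3 2 0 ∨ Is4 c 3 3 1 1)) := by
  have hn8 : n ≤ 8 := by omega
  have a1 := hanti 0 1 (by omega)
  have a2 := hanti 1 2 (by omega)
  have a3 := hanti 2 3 (by omega)
  have a4 := hanti 3 4 (by omega)
  have s5 : c 0 + c 1 + c 2 + c 3 + c 4 ≤ n ∧ (c 4 = 0 → c 0 + c 1 + c 2 + c 3 = n) := by
    obtain ⟨k, rfl⟩ := Nat.exists_eq_add_of_le hn
    rw [Finset.sum_range_add] at hsum
    simp only [Finset.sum_range_succ, Finset.sum_range_zero, zero_add] at hsum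
    constructor
    · rcases Nat.eq_zero_or_pos k with hk | hk
      · have := hz 4 (by omega)
        omega
      · have : c (4 + 0) ≤ ∑ x ∈ Finset.range k, c (4 + x) :=
          Finset.single_le_sum (f := fun x => c (4 + x)) (fun _ _ => Nat.zero_le _)
            (Finset.mem_range.2 hk)
        rw [Nat.add_zero] at this
        omega
    · intro h4
      have : ∑ x ∈ Finset.range k, c (4 + x) = 0 := by
        apply Finset.sum_eq_zero
        intro x _
        have := hanti 4 (4 + x) (by omega)
        omega
      omega
  have z4 : c 4 = 0 := by
    by_contra hne
    omega
  have zz : ∀ j, 4 ≤ j → c j = 0 := fun j hj => by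
    have := hanti 4 j hj; omega
  have s4 := s5.2 z4
  have h30 : c 3 = 0 ∨ c 3 = 1 := by omega
  clear hsum hanti hz s5
  have hcases : n = 4 ∨ n = 5 ∨ n = 6 ∨ n = 7 ∨ n = 8 := by omega
  rcases hcases with rfl | rfl | rfl | rfl | rfl <;> rcases h30 with h30 | h30
  · exact Or.inl ⟨rfl, Or.inl ⟨by omega, by omega, by omega, h30, zz⟩⟩
  · exact Or.inl ⟨rfl, Or.inr ⟨by omega, by omega, by omega, h30, zz⟩⟩
  · exact Or.inr (Or.inl ⟨rfl, Or.inl ⟨by omega, by omega, by omega, h30, zz⟩⟩)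
  · exact Or.inr (Or.inl ⟨rfl, Or.inr ⟨by omega, by omega, by omega, h30, zz⟩⟩)
  · exact Or.inr (Or.inr (Or.inl ⟨rfl, Or.inl ⟨by omega, by omega, by omega, h30, zz⟩⟩))
  · exact Or.inr (Or.inr (Or.inl ⟨rfl, Or.inr ⟨by omega, by omega, by omega, h30, zz⟩⟩))
  · exact Or.inr (Or.inr (Or.inr (Or.inl ⟨rfl, Or.inl ⟨by omega, by omega, by omega, h30, zz⟩⟩)))
  · exact Or.inr (Or.inr (Or.inr (Or.inl ⟨rfl, Or.inr ⟨by omega, by omega, by omega, h30, zz⟩⟩)))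
  · exact Or.inr (Or.inr (Or.inr (Or.inr (⟨rfl, Or.inl ⟨by omega, by omega, by omega, h30, zz⟩⟩))))
  · exact Or.inr (Or.inr (Or.inr (Or.inr (⟨rfl, Or.inr ⟨by omega, by omega, by omega, h30, zz⟩⟩))))

lemma small_unique (hn : n ≤ 3) (c : ℕ → ℕ) (hanti : ∀ i j, i ≤ j → c j ≤ c i)
    (hsum : ∑ j ∈ Finset.range n, c j = n) (hz : ∀ j, n ≤ j → c j = 0)
    (h1 : 1 ≤ n → c 0 ≤ (n + 2) / 3) (j : ℕ) : c j = if j < n then 1 else 0 := by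
  by_cases hj : j < n
  · rw [if_pos hj]
    have hle : ∀ i ∈ Finset.range n, c i ≤ 1 := fun i _ => by
      have := hanti 0 i (by omega)
      have := h1 (by omega)
      omega
    have := (Finset.sum_eq_sum_iff_of_le (g := fun _ => 1) hle).1 (by rw [hsum]; simp)
    exact this j (Finset.mem_range.2 hj)
  · rw [if_neg hj, hz j (by omega)]

lemma csb_one (q : Nat.Partition n) : csb (bp q) 1 = cjb (bp q) 0 := by
  rw [csb_range]; simp

lemma csb_two (q : Nat.Partition n) : csb (bp q) 2 = cjb (bp q) 0 + cjb (bp q) 1 := by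
  rw [csb_range]; simp [Finset.sum_range_succ]

lemma csb_three (q : Nat.Partition n) :
    csb (bp q) 3 = cjb (bp q) 0 + cjb (bp q) 1 + cjb (bp q) 2 := by
  rw [csb_range]; simp [Finset.sum_range_succ]

lemma Mq_bound (hN : n ≤ N) (q p : Nat.Partition n) (k : ℕ) (hk : 1 ≤ k) (hkn : k ≤ n)
    (he : ∀ k' < k, csb (bp p) k' = csb (bp q) k') (h2 : cjb (bp q) (k - 1) = 2)
    (h3 : cjb (bp q) k < 2) (h4 : ∀ j, 4 ≤ j → cjb (bp p) j = 0) : Mq N q p ≤ 5 - k := by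
  have : ∃ i, bp q i = k := by
    unfold cjb at h2 h3
    obtain ⟨i, hi, hi'⟩ := Finset.exists_mem_notMem_of_card_lt_card (lt_of_lt_of_eq h3 h2.symm)
    simp only [Finset.mem_filter, Finset.mem_univ, true_and] at hi hi'
    exact ⟨i, by omega⟩
  obtain ⟨i1, hi1⟩ := this
  exact fam_bound (bp q) (bp p) k (hkn.trans hN) hk he h2 i1 hi1 h4

/-- Feasibility of partitions with a nonzero coefficient. -/
def Feas (q : Nat.Partition n) : Prop :=
  (1 ≤ n → csb (bp q) 1 ≤ (n + 2) / 3) ∧ (2 ≤ n → csb (bp q) 2 ≤ n - n / 3)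

/-- The pairs which interact. -/
def Pair (p q : Nat.Partition n) : Prop :=
  ∃ K, Mq N q p ≤ K ∧ ∀ (G : SimpleGraph (Fin n)), IsNUIG G → Sq G → ∀ m,
    K * (cols N G (nu N q) m).card ≤ (cols N G (nu N p) m).card

lemma pair_split (hN : n ≤ N) (hn : 4 ≤ n) (p q : Nat.Partition n) (a b : ℕ)
    (hp : Is4 (cjb (bp p)) a b 1 1) (hq : Is4 (cjb (bp q)) a b 2 0) : Pair (N := N) p q := by
  obtain ⟨p0, p1, p2, p3, p4⟩ := hp
  obtain ⟨q0, q1, q2, q3, q4⟩ := hq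
  refine ⟨2, ?_, ?_⟩
  · refine Mq_bound hN q p 3 (by omega) (by omega) ?_ q2 (by omega) p4
    intro k hk
    rw [csb_range, csb_range]
    refine Finset.sum_congr rfl (fun j hj => ?_)
    rw [Finset.mem_range] at hj
    have : j = 0 ∨ j = 1 := by omega
    rcases this with rfl | rfl
    · rw [p0, q0]
    · rw [p1, q1]
  · intro G _ _ m
    refine split_ineq (by omega) G _ _ m q2 ?_ p2 p3 ?_
    · intro j hj
      unfold nu
      rcases Nat.eq_or_lt_of_le hj with h | h
      · rw [← h]; exact q3
      · exact q4 _ h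
    · intro j h2 h3
      unfold nu
      have : (j : ℕ) = 0 ∨ (j : ℕ) = 1 ∨ 4 ≤ (j : ℕ) := by omega
      rcases this with h | h | h
      · rw [h, p0, q0]
      · rw [h, p1, q1]
      · rw [p4 _ h, q4 _ h]

lemma pair_four (hN : 4 ≤ N) (p q : Nat.Partition 4)
    (hp : Is4 (cjb (bp p)) 1 1 1 1) (hq : Is4 (cjb (bp q)) 2 1 1 0) : Pair (N := N) p q := by
  obtain ⟨p0, p1, p2, p3, p4⟩ := hp
  obtain ⟨q0, q1, q2, q3, q4⟩ := hq
  refine ⟨4, ?_, ?_⟩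
  · refine Mq_bound hN q p 1 (by omega) (by omega) ?_ q0 (by omega) p4
    intro k hk
    have : k = 0 := by omega
    rw [this, csb_range, csb_range]; rfl
  · intro G _ hs m
    refine four_ineq hN G hs _ _ m q0 ?_ ?_ ?_
    · intro j hj
      unfold nu
      rcases Nat.eq_or_lt_of_le hj with h | h
      · rw [← h]; exact q3
      · exact q4 _ h
    · intro j hj
      unfold nu
      have : (j : ℕ) = 0 ∨ (j : ℕ) = 1 ∨ (j : ℕ) = 2 ∨ (j : ℕ) = 3 := by omega
      rcases this with h | h | h | h <;> rw [h] <;> assumption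
    · intro j hj
      exact p4 _ hj

lemma pair_five (hN : 5 ≤ N) (p q : Nat.Partition 5)
    (hp : Is4 (cjb (bp p)) 2 1 1 1) (hq : Is4 (cjb (bp q)) 2 2 1 0) : Pair (N := N) p q := by
  obtain ⟨p0, p1, p2, p3, p4⟩ := hp
  obtain ⟨q0, q1, q2, q3, q4⟩ := hq
  refine ⟨3, ?_, ?_⟩
  · refine Mq_bound hN q p 2 (by omega) (by omega) ?_ q1 (by omega) p4
    intro k hk
    rw [csb_range, csb_range]
    refine Finset.sum_congr rfl (fun j hj => ?_)
    rw [Finset.mem_range] at hj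
    have : j = 0 := by omega
    rw [this, p0, q0]
  · intro G hG hs m
    refine five_ineq (by omega) G hG hs _ _ m q0 q1 ?_ p0 ?_ ?_
    · intro j hj
      unfold nu
      rcases Nat.eq_or_lt_of_le hj with h | h
      · rw [← h]; exact q3
      · exact q4 _ h
    · intro j hj h0
      unfold nu
      have : (j : ℕ) = 1 ∨ (j : ℕ) = 2 ∨ (j : ℕ) = 3 := by omega
      rcases this with h | h | h <;> rw [h] <;> assumption
    · intro j hj
      exact p4 _ hj

/-- Feasible partitions near the top: two per `n`. -/
def Top (q : Nat.Partition n) : Prop := n ≤ 3 ∨ cjb (bp q) 3 = 0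

lemma feas_cases (q : Nat.Partition n) (h : Feas q) (h2 : n ≤ csb (bp q) 2 + 2) (hn : 4 ≤ n) :
    (n = 4 ∧ (Is4 (cjb (bp q)) 2 1 1 0 ∨ Is4 (cjb (bp q)) 1 1 1 1)) ∨
    (n = 5 ∧ (Is4 (cjb (bp q)) 2 2 1 0 ∨ Is4 (cjb (bp q)) 2 1 1 1)) ∨
    (n = 6 ∧ (Is4 (cjb (bp q)) 2 2 2 0 ∨ Is4 (cjb (bp q)) 2 2 1 1)) ∨
    (n = 7 ∧ (Is4 (cjb (bp q)) 3 2 2 0 ∨ Is4 (cjb (bp q)) 3 2 1 1)) ∨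
    (n = 8 ∧ (Is4 (cjb (bp q)) 3 3 2 0 ∨ Is4 (cjb (bp q)) 3 3 1 1)) := by
  have e1 := h.1 (by omega)
  have e2 := h.2 (by omega)
  rw [csb_one] at e1
  rw [csb_two] at e2 h2
  exact classify_big hn _ (fun i j => cjb_anti q) (by rw [← csb_range, csb_bp_n])
    (fun j => cjb_ge q) e1 e2 h2

lemma top_unique (p q : Nat.Partition n) (hp : Feas p) (hq : Feas q)
    (hp2 : n ≤ csb (bp p) 2 + 2) (hq2 : n ≤ csb (bp q) 2 + 2)
    (h : n ≤ 3 ∨ (cjb (bp p) 3 = 0 ↔ cjb (bp q) 3 = 0)) : p = q := by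
  apply cjb_inj
  by_cases hn : n ≤ 3
  · intro j
    have key : ∀ q : Nat.Partition n, Feas q → cjb (bp q) j = if j < n then 1 else 0 :=
      fun q hq => small_unique hn _ (fun i j => cjb_anti q) (by rw [← csb_range, csb_bp_n])
        (fun j => cjb_ge q) (fun h => by have := hq.1 h; rwa [csb_one] at this) j
    rw [key p hp, key q hq]
  · have h := h.resolve_left hn
    rcases feas_cases p hp hp2 (by omega) with ⟨e, a | a⟩ | ⟨e, a | a⟩ | ⟨e, a | a⟩ | ⟨e, a | a⟩ |
      ⟨e, a | a⟩ <;>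
    rcases feas_cases q hq hq2 (by omega) with ⟨e', a' | a'⟩ | ⟨e', a' | a'⟩ | ⟨e', a' | a'⟩ |
      ⟨e', a' | a'⟩ | ⟨e', a' | a'⟩ <;>
    first
    | exact a.ext a'
    | (exfalso; have u := a.2.2.2.1; have v := a'.2.2.2.1; omega)

lemma pair_of (hN : n ≤ N) (p q : Nat.Partition n) (hp : Feas p) (hq : Feas q)
    (hp2 : n ≤ csb (bp p) 2 + 2) (hq2 : n ≤ csb (bp q) 2 + 2) (hn : 4 ≤ n)
    (h : cjb (bp p) 3 ≠ 0) (h' : cjb (bp q) 3 = 0) : Pair (N := N) p q := by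
  rcases feas_cases p hp hp2 (by omega) with ⟨e, a | a⟩ | ⟨e, a | a⟩ | ⟨e, a | a⟩ | ⟨e, a | a⟩ |
      ⟨e, a | a⟩ <;>
    rcases feas_cases q hq hq2 (by omega) with ⟨e', a' | a'⟩ | ⟨e', a' | a'⟩ | ⟨e', a' | a'⟩ |
      ⟨e', a' | a'⟩ | ⟨e', a' | a'⟩ <;>
    first
    | (exfalso; have u := a.2.2.2.1; have v := a'.2.2.2.1; omega)
    | (subst e; exact pair_four hN p q a a')
    | (subst e; exact pair_five hN p q a a')
    | exact pair_split hN hn p q _ _ a a'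

lemma dom_three (p q : Nat.Partition n) (hp : Feas p) (hq : Feas q)
    (hp2 : n ≤ csb (bp p) 2 + 2) (hq2 : n ≤ csb (bp q) 2 + 2) (hn : 4 ≤ n)
    (h : cjb (bp p) 3 = 0) (hd : csb (bp p) 3 ≤ csb (bp q) 3) : cjb (bp q) 3 = 0 := by
  rw [csb_three, csb_three] at hd
  rcases feas_cases p hp hp2 (by omega) with ⟨e, a | a⟩ | ⟨e, a | a⟩ | ⟨e, a | a⟩ | ⟨e, a | a⟩ |
      ⟨e, a | a⟩ <;>
    rcases feas_cases q hq hq2 (by omega) with ⟨e', a' | a'⟩ | ⟨e', a' | a'⟩ | ⟨e', a' | a'⟩ |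
      ⟨e', a' | a'⟩ | ⟨e', a' | a'⟩ <;>
    (obtain ⟨u0, u1, u2, u3, -⟩ := a; obtain ⟨v0, v1, v2, v3, -⟩ := a'; omega)

theorem q_part (hN : n ≤ N) (G : SimpleGraph (Fin n)) (hG : IsNUIG G)
    (hconn : G.Connected) (hcut : ∀ v, ¬ IsCutVertex G v)
    (c : Nat.Partition n → Polynomial ℤ)
    (h : chromQSym n N G = ∑ q : Nat.Partition n, C (c q) * eProd N (Polynomial ℤ) q)
    (p : Nat.Partition n) (hp2 : n ≤ csb (bp p) 2 + 2) (m : ℕ) : 0 ≤ (c p).coeff m := by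
  have hs := sq_of G hG hconn hcut
  have hfeas : ∀ q, (c q).coeff m ≠ 0 → Feas q := fun q hq =>
    ⟨fun hn => vanish hN G c h 1 _ hn (fun κ hκ => bound_one hs hκ) q m hq,
     fun hn => vanish hN G c h 2 _ hn (fun κ hκ => bound_two hs hκ) q m hq⟩
  by_cases hcp : (c p).coeff m = 0
  · rw [hcp]
  have hpF := hfeas p hcp
  have hex : ∀ q p : Nat.Partition n, n ≤ csb (bp p) 2 + 2 → Mq N q p ≠ 0 →
      n ≤ csb (bp q) 2 + 2 := by
    intro q p hp2 hM
    by_cases hn : 2 ≤ n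
    · have := Mq_dom hN hM 2 hn
      omega
    · omega
  have htop : ∀ p : Nat.Partition n, n ≤ csb (bp p) 2 + 2 → Feas p →
      (n ≤ 3 ∨ cjb (bp p) 3 = 0) →
      (c p).coeff m = ((cols N G (nu N p) m).card : ℤ) := by
    intro p hp2 hpF ht
    rw [← master G c h p m, Finset.sum_eq_single p, Mq_self hN]
    · simp
    · intro q _ hne
      by_contra hmul
      have hc : (c q).coeff m ≠ 0 := fun h => hmul (by rw [h, zero_mul])
      have hM : Mq N q p ≠ 0 := fun h => hmul (by rw [h]; simp)
      refine hne (top_unique q p (hfeas q hc) hpF (hex q p hp2 hM) hp2 ?_)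
      by_cases hn : n ≤ 3
      · exact Or.inl hn
      · right
        have ht := ht.resolve_left hn
        exact ⟨fun _ => ht, fun _ => dom_three p q hpF (hfeas q hc) hp2 (hex q p hp2 hM)
          (by omega) ht (Mq_dom hN hM 3 (by omega))⟩
    · intro h; exact absurd (Finset.mem_univ _) h
  by_cases ht : n ≤ 3 ∨ cjb (bp p) 3 = 0
  · rw [htop p hp2 hpF ht]
    positivity
  · push Not at ht
    by_cases hq : ∃ q, (c q).coeff m ≠ 0 ∧ Mq N q p ≠ 0 ∧ q ≠ p
    · obtain ⟨q, hc, hM, hne⟩ := hq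
      have hq2 := hex q p hp2 hM
      have hqF := hfeas q hc
      have hq3 : cjb (bp q) 3 = 0 := by
        by_contra h3
        exact hne (top_unique q p hqF hpF hq2 hp2 (Or.inr ⟨fun h => absurd h h3,
          fun h => absurd h ht.2⟩))
      obtain ⟨K, hK, hin⟩ := pair_of hN p q hpF hqF hp2 hq2 (by omega) ht.2 hq3
      have e1 := htop q hq2 hqF (Or.inr hq3)
      have e2 := master G c h p m
      have e3 : ∑ q', (c q').coeff m * (Mq N q' p : ℤ) =
          (c p).coeff m * (Mq N p p : ℤ) + (c q).coeff m * (Mq N q p : ℤ) := by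
        rw [← Finset.sum_pair (f := fun q' => (c q').coeff m * (Mq N q' p : ℤ)) hne.symm]
        symm
        apply Finset.sum_subset (Finset.subset_univ _)
        intro q' _ hq'
        simp only [Finset.mem_insert, Finset.mem_singleton, not_or] at hq'
        by_contra hmul
        have hc' : (c q').coeff m ≠ 0 := fun h => hmul (by rw [h, zero_mul])
        have hM' : Mq N q' p ≠ 0 := fun h => hmul (by rw [h]; simp)
        have hq'2 := hex q' p hp2 hM'
        by_cases h3 : cjb (bp q') 3 = 0
        · exact hq'.2 (top_unique q' q (hfeas q' hc') hqF hq'2 hq2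
            (Or.inr ⟨fun _ => hq3, fun _ => h3⟩))
        · exact hq'.1 (top_unique q' p (hfeas q' hc') hpF hq'2 hp2
            (Or.inr ⟨fun h => absurd h h3, fun h => absurd h ht.2⟩))
      rw [e3, Mq_self hN, e1] at e2
      have e4 := hin G hG hs m
      have e5 : Mq N q p * (cols N G (nu N q) m).card ≤ (cols N G (nu N p) m).card :=
        (Nat.mul_le_mul_right _ hK).trans e4
      have e6 : (Mq N q p : ℤ) * ((cols N G (nu N q) m).card : ℤ) ≤
          ((cols N G (nu N p) m).card : ℤ) := by exact_mod_cast e5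
      push_cast at e2
      linarith
    · have e2 := master G c h p m
      rw [Finset.sum_eq_single p, Mq_self hN] at e2
      · have : (c p).coeff m = ((cols N G (nu N p) m).card : ℤ) := by simpa using e2
        rw [this]; positivity
      · intro q _ hne
        by_contra hmul
        exact hq ⟨q, fun h => hmul (by rw [h, zero_mul]), fun h => hmul (by rw [h]; simp), hne⟩
      · intro h; exact absurd (Finset.mem_univ _) h

lemma shape_bound (w : ℕ) (hw : w ≤ 4) (μ : Nat.Partition w) (a b : ℕ) (p : Nat.Partition n)
    (hshape : p.parts = μ.parts + Multiset.replicate a 2 + Multiset.replicate b 1) :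
    n ≤ csb (bp p) 2 + 2 := by
  have h1 : csb (bp p) 2 = (p.parts.map (fun x => min x 2)).sum := sum_bp p (fun x => min x 2)
  generalize csb (bp p) 2 = t at *
  have h2 := p.parts_sum
  have h3 := μ.parts_sum
  rw [hshape] at h1 h2
  have key : ∀ s : Multiset ℕ, (∀ x ∈ s, x ≤ 4) →
      s.sum ≤ 2 * (s.map (fun x => min x 2)).sum := by
    intro s
    induction s using Multiset.induction_on with
    | empty => simp
    | cons x s ih =>
      intro hx
      have e1 := ih (fun y hy => hx y (Multiset.mem_cons_of_mem hy))
      have e2 := hx x (Multiset.mem_cons_self x s)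
      rw [Multiset.sum_cons, Multiset.map_cons, Multiset.sum_cons]
      have e3 : x ≤ 2 * min x 2 := by omega
      omega
  have h4 := key μ.parts (fun x hx => (part_le μ hx).trans hw)
  simp only [Multiset.map_add, Multiset.sum_add, Multiset.map_replicate,
    Multiset.sum_replicate, smul_eq_mul] at h1 h2
  norm_num at h1 h2
  omega

end FinalQ

end SS

/-- for a connected natural unit interval graph with no cut
vertex and `λ = (μ_1,…,μ_k,2,…,2,1,…,1)`: if `|μ| ≤ 4` then `c_λ(q)` has
nonnegative coefficients, and if `|μ| ≤ 8` then `c_λ ≥ 0`. -/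
theorem stmt9 (n N : ℕ) (hN : n ≤ N) (G : SimpleGraph (Fin n)) (hG : IsNUIG G)
    (hconn : G.Connected) (hcut : ∀ v, ¬ IsCutVertex G v)
    (w : ℕ) (μ : Nat.Partition w) (a b : ℕ) (p : Nat.Partition n)
    (hshape : p.parts = μ.parts + Multiset.replicate a 2 + Multiset.replicate b 1) :
    (w ≤ 4 → ∀ c : Nat.Partition n → Polynomial ℤ,
      chromQSym n N G = ∑ q : Nat.Partition n, C (c q) * eProd N (Polynomial ℤ) q →
      ∀ m, 0 ≤ (c p).coeff m) ∧
    (w ≤ 8 → ∀ c : Nat.Partition n → ℤ,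
      chromSym n N G = ∑ q : Nat.Partition n, C (c q) * eProd N ℤ q →
      0 ≤ c p) := by
  exact ⟨fun hw c h m => SS.q_part hN G hG hconn hcut c h p (SS.shape_bound w hw μ a b p hshape) m,
    fun _ c h => SS.q1_part n hN G hG c h p⟩
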